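/- arXiv:2201.09994 — 2 statements merged into one kernel-verified Lean document; each statement's English description precedes it below -/
import Mathlib

section
/- Let I ⊂ S be a homogeneous d-equigenerated ideal of height c ≥ 2 and projective dimension 3. Then β_2(S/I) ≤ d(d+2) and β_3(S/I) ≤ d(d+1)/2. -/
/-- The free graded module with `b j` generators in degree `j` (i.e. `⊕_j A(-j)^{b j}`). -/
abbrev FreeMod (A : Type*) [CommRing A] (b : ℤ → ℕ) : Type _ :=
  ((j : ℤ) × Fin (b j)) →₀ A

/-- A minimal graded free resolution of the module `M` over the (graded) commutative ring `A`,
where `hom m` is the set of homogeneous elements of degree `m` of `A`.  The data records the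
graded Betti numbers `β i j` (the number of copies of `A(-j)` in homological degree `i`),
the differentials and the augmentation; the conditions say that the differentials are graded of
degree `0` (the entries of their matrices are homogeneous of the appropriate degree), that the
resolution is minimal (all entries have positive degree, equivalently lie in the irrelevant
maximal ideal), and that the complex is exact, resolving `M`. -/
structure MinGradedFreeRes (A : Type*) [CommRing A] (hom : ℕ → Set A)
    (M : Type*) [AddCommGroup M] [Module A M] where
  β : ℕ → ℤ → ℕ
  finβ : ∀ i, (Function.support (β i)).Finite
  d : ∀ i, FreeMod A (β (i + 1)) →ₗ[A] FreeMod A (β i)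
  aug : FreeMod A (β 0) →ₗ[A] M
  graded : ∀ (i : ℕ) (j : ℤ) (a : Fin (β (i + 1) j)) (j' : ℤ) (a' : Fin (β i j')),
      d i (Finsupp.single ⟨j, a⟩ 1) ⟨j', a'⟩ = 0 ∨
      ∃ m : ℕ, (m : ℤ) = j - j' ∧ d i (Finsupp.single ⟨j, a⟩ 1) ⟨j', a'⟩ ∈ hom m
  minimal : ∀ (i : ℕ) (j : ℤ) (a : Fin (β (i + 1) j)) (j' : ℤ) (a' : Fin (β i j')),
      d i (Finsupp.single ⟨j, a⟩ 1) ⟨j', a'⟩ ≠ 0 → j' < j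
  augSurj : Function.Surjective aug
  exact₀ : LinearMap.range (d 0) = LinearMap.ker aug
  exact : ∀ i, LinearMap.range (d (i + 1)) = LinearMap.ker (d i)

/-- The `i`-th total Betti number of a resolution. -/
noncomputable def MinGradedFreeRes.tB {A : Type*} [CommRing A] {hom : ℕ → Set A}
    {M : Type*} [AddCommGroup M] [Module A M]
    (res : MinGradedFreeRes A hom M) (i : ℕ) : ℕ :=
  ∑ j ∈ (res.finβ i).toFinset, res.β i j

/-- The height of an ideal: the infimum of the heights of the primes containing it. -/
noncomputable def idealHeight {A : Type*} [CommRing A] (I : Ideal A) : ℕ∞ :=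
  ⨅ (P : PrimeSpectrum A) (_ : I ≤ P.asIdeal), Order.height P

namespace BB
open MvPolynomial

/-- generic coefficient ring -/
abbrev GA (k : Type) [Field k] (n r : ℕ) : Type := MvPolynomial (Fin n × (Fin r → Bool)) k

/-- Laurent ring -/
abbrev LR (k : Type) [Field k] (n r : ℕ) : Type := AddMonoidAlgebra (GA k n r) (Fin r → ℤ)

section
variable {k : Type} [Field k] {n r : ℕ}

noncomputable def mon (k : Type) [Field k] (n : ℕ) {r : ℕ} (c j : Fin r → Bool) : MvPolynomial (Fin r) (GA k n r) :=
  ∏ i, if j i = c i then 1 else X i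

noncomputable def phiC (k : Type) [Field k] (n : ℕ) {r : ℕ} (c : Fin r → Bool) :
    MvPolynomial (Fin n) k →+* MvPolynomial (Fin r) (GA k n r) :=
  eval₂Hom (C.comp C) (fun i => ∑ j, C (X (i, j)) * mon k n c j)

abbrev Rho (n : ℕ) {r : ℕ} (c : Fin r → Bool) : Type := Fin r ⊕ (Fin n × {j : Fin r → Bool // j ≠ c})

noncomputable def fwd (k : Type) [Field k] (n : ℕ) {r : ℕ} (c : Fin r → Bool) :
    MvPolynomial (Rho n c) (MvPolynomial (Fin n) k) →+* MvPolynomial (Fin r) (GA k n r) :=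
  eval₂Hom (phiC k n c) (Sum.elim X (fun p => C (X (p.1, p.2.1))))

noncomputable def monR (k : Type) [Field k] (n : ℕ) {r : ℕ} (c j : Fin r → Bool) :
    MvPolynomial (Rho n c) (MvPolynomial (Fin n) k) :=
  ∏ i, if j i = c i then 1 else X (Sum.inl i)

noncomputable def bwd (k : Type) [Field k] (n : ℕ) {r : ℕ} (c : Fin r → Bool) :
    MvPolynomial (Fin r) (GA k n r) →+* MvPolynomial (Rho n c) (MvPolynomial (Fin n) k) :=
  eval₂Hom (eval₂Hom (C.comp C) (fun p => if h : p.2 = c then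
      C (X p.1) - ∑ j : {j : Fin r → Bool // j ≠ c}, X (Sum.inr (p.1, j)) * monR k n c j.1
      else X (Sum.inr (p.1, ⟨p.2, h⟩)))) (fun i => X (Sum.inl i))

lemma mon_self (c : Fin r → Bool) : mon k n c c = 1 := by simp [mon]

lemma fwd_monR (c j : Fin r → Bool) : fwd k n c (monR k n c j) = mon k n c j := by
  simp only [fwd, monR, mon, map_prod]
  refine Finset.prod_congr rfl fun i _ => ?_
  split_ifs <;> simp

lemma bwd_mon (c j : Fin r → Bool) : bwd k n c (mon k n c j) = monR k n c j := by
  simp only [bwd, monR, mon, map_prod]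
  refine Finset.prod_congr rfl fun i _ => ?_
  split_ifs <;> simp

lemma phiC_X (c : Fin r → Bool) (i : Fin n) : phiC k n c (X i) =
    C (X (i, c)) + ∑ j : {j : Fin r → Bool // j ≠ c}, C (X (i, j.1)) * mon k n c j.1 := by
  have h1 : phiC k n c (X i) = ∑ j, C (X (i, j)) * mon k n c j := by simp [phiC]
  rw [h1, Fintype.sum_eq_add_sum_subtype_ne _ c, mon_self, mul_one]

lemma bwd_C_ne (c : Fin r → Bool) (i : Fin n) (j : {j : Fin r → Bool // j ≠ c}) :
    bwd k n c (C (X (i, j.1))) = X (Sum.inr (i, j)) := by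
  simp [bwd, j.2]

lemma bwd_C_self (c : Fin r → Bool) (i : Fin n) :
    bwd k n c (C (X (i, c))) = C (X i) - ∑ j : {j : Fin r → Bool // j ≠ c}, X (Sum.inr (i, j)) * monR k n c j.1 := by
  simp [bwd]

lemma bwd_C_C (c : Fin r → Bool) (a : k) : bwd k n c (C (C a)) = C (C a) := by simp [bwd]

lemma phiC_C (c : Fin r → Bool) (a : k) : phiC k n c (C a) = C (C a) := by simp [phiC]

lemma fwd_C (c : Fin r → Bool) (a) : fwd k n c (C a) = phiC k n c a := by simp [fwd]

lemma bwd_fwd (c : Fin r → Bool) : (bwd k n c).comp (fwd k n c) = RingHom.id _ := by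
  apply MvPolynomial.ringHom_ext
  · intro s
    have : ((bwd k n c).comp (phiC k n c)) = C := by
      apply MvPolynomial.ringHom_ext
      · intro a
        rw [RingHom.comp_apply, phiC_C, bwd_C_C]
      · intro i
        rw [RingHom.comp_apply, phiC_X, map_add, map_sum, bwd_C_self]
        simp only [map_mul, bwd_C_ne, bwd_mon]
        ring
    rw [RingHom.comp_apply, fwd_C, ← RingHom.comp_apply, this]; rfl
  · rintro (i | ⟨i, j⟩)
    · simp [fwd, bwd]
    · rw [RingHom.comp_apply]
      have : fwd k n c (X (Sum.inr (i, j))) = C (X (i, j.1)) := by simp [fwd]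
      rw [this, bwd_C_ne]; rfl

lemma fwd_bwd (c : Fin r → Bool) : (fwd k n c).comp (bwd k n c) = RingHom.id _ := by
  apply MvPolynomial.ringHom_ext
  · intro s
    have : ((fwd k n c).comp (bwd k n c)).comp C = C := by
      apply MvPolynomial.ringHom_ext
      · intro a
        simp only [RingHom.comp_apply]
        rw [bwd_C_C, fwd_C, phiC_C]
      · rintro ⟨i, j⟩
        simp only [RingHom.comp_apply]
        have h2 : ∀ j : {j : Fin r → Bool // j ≠ c}, fwd k n c (X (Sum.inr (i, j))) = C (X (i, j.1)) := by
          intro j; simp [fwd]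
        by_cases h : j = c
        · subst h
          rw [bwd_C_self, map_sub, fwd_C, phiC_X, map_sum]
          simp only [map_mul, h2, fwd_monR]
          ring
        · rw [bwd_C_ne c i ⟨j, h⟩, h2]
    exact congrArg (fun f => f s) this
  · intro i
    simp [fwd, bwd]

lemma phiC_flat (c : Fin r → Bool) : (phiC k n c).Flat := by
  have h1 : phiC k n c = (fwd k n c).comp C := by
    refine RingHom.ext fun s => ?_
    rw [RingHom.comp_apply, fwd_C]
  rw [h1]
  apply RingHom.Flat.comp
  · have : (algebraMap (MvPolynomial (Fin n) k) (MvPolynomial (Rho n c) (MvPolynomial (Fin n) k))).Flat := by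
      rw [RingHom.flat_algebraMap_iff]; infer_instance
    exact this
  · apply RingHom.Flat.of_bijective
    refine ⟨Function.LeftInverse.injective (g := bwd k n c) fun x => ?_,
      Function.RightInverse.surjective (g := bwd k n c) fun x => ?_⟩
    · exact congrArg (fun f => f x) (bwd_fwd c)
    · exact congrArg (fun f => f x) (fwd_bwd c)

end

/-- exactness of a pair of matrices -/
def Ex {S : Type} [CommRing S] {α β γ : Type} [Fintype β] [Fintype γ]
    (P : α → β → S) (Q : β → γ → S) : Prop :=
  ∀ v : β → S, (∀ x, ∑ y, P x y * v y = 0) → ∃ w : γ → S, ∀ y, v y = ∑ z, Q y z * w z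

/-- flat base change of exactness, for matrices -/
lemma flat_exact {S B : Type} [CommRing S] [CommRing B] (φ : S →+* B) (hφ : φ.Flat)
    {α β γ : Type} [Fintype α] [Fintype β] [Fintype γ]
    (P : α → β → S) (Q : β → γ → S) (hex : Ex P Q)
    (v : β → B) (hv : ∀ x, ∑ y, φ (P x y) * v y = 0) :
    ∃ w : γ → B, ∀ y, v y = ∑ z, φ (Q y z) * w z := by
  classical
  let _ := φ.toAlgebra
  have : Module.Flat S B := hφ
  have hal : algebraMap S B = φ := rfl
  let x : (β → S) →ₗ[S] B := Fintype.linearCombination S v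
  let f : (α → S) →ₗ[S] (β → S) := Fintype.linearCombination S P
  have hx : x ∘ₗ f = 0 := by
    ext a
    have h1 : f (Pi.single a 1) = P a := by simp [f]
    change x (f (Pi.single a 1)) = 0
    rw [h1]
    simpa [x, Algebra.smul_def, hal, Fintype.linearCombination_apply] using hv a
  obtain ⟨m, a, y, hxy, haf⟩ := Module.Flat.exists_factorization_of_comp_eq_zero_of_free hx
  have hcol : ∀ i : Fin m, ∃ w : γ → S, ∀ b, a (Pi.single b 1) i = ∑ z, Q b z * w z := by
    intro i
    apply hex
    intro p
    have h := congrArg (fun g => g (Pi.single p 1) i) haf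
    have h1 : f (Pi.single p 1) = P p := by simp [f]
    simp only [LinearMap.comp_apply, h1] at h
    have h2 : P p = ∑ b, P p b • (Pi.single b (1 : S) : β → S) := by
      ext b; simp [Finset.sum_apply, Pi.single_apply]
    rw [h2, map_sum] at h
    simpa [Finsupp.finsetSum_apply] using h
  choose w hw using hcol
  refine ⟨fun z => ∑ i, φ (w i z) * y (Finsupp.single i 1), fun b => ?_⟩
  have hvb : v b = x (Pi.single b 1) := by simp [x]
  have h3 : a (Pi.single b 1) = ∑ i, (a (Pi.single b 1) i) • Finsupp.single i (1 : S) := by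
    ext i; simp
  rw [hvb, hxy, LinearMap.comp_apply, h3, map_sum]
  simp only [map_smul, Algebra.smul_def, Finset.mul_sum, hal]
  rw [Finset.sum_comm]
  refine Finset.sum_congr rfl fun i _ => ?_
  rw [hw i b]
  simp only [map_sum, map_mul, Finset.sum_mul, mul_assoc]

section
variable {k : Type} [Field k] {n r : ℕ}

noncomputable def sgn {r : ℕ} (c : Fin r → Bool) : (Fin r →₀ ℕ) →+ (Fin r → ℤ) where
  toFun μ i := if c i then -(μ i : ℤ) else (μ i : ℤ)
  map_zero' := by ext i; simp
  map_add' a b := by ext i; simp only [Finsupp.add_apply, Pi.add_apply]; split_ifs <;> push_cast <;> ring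

lemma sgn_apply (c : Fin r → Bool) (μ : Fin r →₀ ℕ) (i : Fin r) :
    sgn c μ i = if c i then -(μ i : ℤ) else (μ i : ℤ) := rfl

lemma sgn_inj (c : Fin r → Bool) : Function.Injective (sgn c) := by
  intro a b h
  ext i
  have := congrFun h i
  simp only [sgn_apply] at this
  split_ifs at this <;> omega

noncomputable def theta (k : Type) [Field k] (n : ℕ) {r : ℕ} (c : Fin r → Bool) :
    MvPolynomial (Fin r) (GA k n r) →+* LR k n r :=
  AddMonoidAlgebra.mapDomainRingHom (GA k n r) (sgn c)

lemma theta_apply (c : Fin r → Bool) (f) : theta k n c f = AddMonoidAlgebra.mapDomain (sgn c) f := rfl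

lemma theta_inj (c : Fin r → Bool) : Function.Injective (theta k n c) :=
  AddMonoidAlgebra.mapDomain_injective (sgn_inj c)

noncomputable def T (k : Type) [Field k] (n : ℕ) {r : ℕ} (γ : Fin r → ℤ) : LR k n r :=
  AddMonoidAlgebra.single γ 1

lemma T_add (γ δ : Fin r → ℤ) : T k n (γ + δ) = T k n γ * T k n δ := by
  simp [T, AddMonoidAlgebra.single_mul_single]

lemma T_zero : T k n (0 : Fin r → ℤ) = 1 := rfl

lemma T_nsmul (m : ℕ) (γ : Fin r → ℤ) : T k n (m • γ) = T k n γ ^ m := by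
  simp [T, AddMonoidAlgebra.single_pow]

def gam {r : ℕ} (j : Fin r → Bool) : Fin r → ℤ := fun i => if j i then 1 else 0

noncomputable def Phi (k : Type) [Field k] (n r : ℕ) : MvPolynomial (Fin n) k →+* LR k n r :=
  eval₂Hom (AddMonoidAlgebra.singleZeroRingHom.comp C)
    (fun i => ∑ j, AddMonoidAlgebra.single (gam j) (X (i, j)))

lemma theta_C (c : Fin r → Bool) (a) : theta k n c (C a) = AddMonoidAlgebra.single 0 a := by
  rw [theta_apply, ← MvPolynomial.monomial_zero']
  change AddMonoidAlgebra.mapDomain (sgn c) (AddMonoidAlgebra.single 0 a) = _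
  rw [AddMonoidAlgebra.mapDomain_single, map_zero]

lemma theta_X (c : Fin r → Bool) (i) : theta k n c (X i) =
    T k n (fun i' => if i' = i then (if c i then -1 else 1) else 0) := by
  rw [theta_apply, T]
  change AddMonoidAlgebra.mapDomain (sgn c) (AddMonoidAlgebra.single (Finsupp.single i 1) 1) = _
  rw [AddMonoidAlgebra.mapDomain_single]
  congr 1
  ext i'
  rw [sgn_apply, Finsupp.single_apply]
  by_cases h : i' = i
  · subst h; simp
  · simp [h, Ne.symm h]

lemma T_sum {ι : Type} (s : Finset ι) (g : ι → Fin r → ℤ) : T k n (∑ i ∈ s, g i) = ∏ i ∈ s, T k n (g i) := by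
  classical
  induction s using Finset.induction_on with
  | empty => simp [T_zero]
  | insert a s ha ih => rw [Finset.sum_insert ha, Finset.prod_insert ha, T_add, ih]

lemma theta_mon (c j : Fin r → Bool) : theta k n c (mon k n c j) = T k n (gam j - gam c) := by
  have h : gam j - gam c = ∑ i, (fun i' => if i' = i then (if j i = c i then 0 else if c i then -1 else 1) else 0) := by
    ext i'
    rw [Finset.sum_apply]
    simp only [Finset.sum_ite_eq, Finset.mem_univ, if_true, Pi.sub_apply, gam]
    cases j i' <;> cases c i' <;> simp
  rw [h, T_sum, mon, map_prod]
  refine Finset.prod_congr rfl fun i _ => ?_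
  split_ifs with h1 h2
  · rw [map_one, ← T_zero]; congr 1; ext i'; simp
  · rw [theta_X, h2]; rfl
  · rw [theta_X, if_neg h2]

lemma theta_phiC_X (c : Fin r → Bool) (i : Fin n) :
    theta k n c (phiC k n c (X i)) = T k n (- gam c) * Phi k n r (X i) := by
  simp only [phiC, Phi, coe_eval₂Hom, eval₂_X, map_sum, map_mul, theta_mon, theta_C, T, Finset.mul_sum,
    AddMonoidAlgebra.single_mul_single]
  refine Finset.sum_congr rfl fun j _ => ?_
  simp [sub_eq_neg_add]

lemma theta_phiC_C (c : Fin r → Bool) (a : k) :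
    theta k n c (phiC k n c (C a)) = Phi k n r (C a) := by
  rw [phiC_C, theta_C]; simp [Phi]

/-- homogeneous of integer degree `δ`, or zero -/
def HD {k : Type} [Field k] {n : ℕ} (f : MvPolynomial (Fin n) k) (δ : ℤ) : Prop :=
  f = 0 ∨ ∃ m : ℕ, (m : ℤ) = δ ∧ f.IsHomogeneous m

lemma hom_scale {R : Type} [CommRing R] (F G : MvPolynomial (Fin n) k →+* R) (u : R)
    (hC : ∀ a, F (C a) = G (C a)) (hX : ∀ i, F (X i) = u * G (X i))
    (f : MvPolynomial (Fin n) k) (m : ℕ) (hf : f.IsHomogeneous m) : F f = u ^ m * G f := by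
  rw [f.as_sum, map_sum, map_sum, Finset.mul_sum]
  refine Finset.sum_congr rfl fun s hs => ?_
  have hdeg := hf (mem_support_iff.1 hs)
  rw [MvPolynomial.monomial_eq, map_mul, map_mul, hC, Finsupp.prod, map_prod, map_prod]
  simp only [map_pow, hX, mul_pow, Finset.prod_mul_distrib, Finset.prod_pow_eq_pow_sum]
  have : ∑ i ∈ s.support, s i = m := by
    rw [← hdeg]; simp [Finsupp.weight_apply, Finsupp.sum]
  rw [this]; ring

lemma Phi_eq (c : Fin r → Bool) (f : MvPolynomial (Fin n) k) (δ : ℤ) (hf : HD f δ) :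
    Phi k n r f = T k n (δ • gam c) * theta k n c (phiC k n c f) := by
  rcases hf with rfl | ⟨m, rfl, hf⟩
  · simp
  have := hom_scale ((theta k n c).comp (phiC k n c)) (Phi k n r) (T k n (- gam c))
    (theta_phiC_C c) (theta_phiC_X c) f m hf
  rw [RingHom.comp_apply] at this
  rw [this, ← T_nsmul, ← mul_assoc, ← T_add]
  have h0 : ((m : ℤ) • gam c + m • -gam c : Fin r → ℤ) = 0 := by simp
  rw [h0, T_zero, one_mul]

/-- elements supported in `N` -/
def sup (k : Type) [Field k] (n : ℕ) {r : ℕ} (N : Set (Fin r → ℤ)) : Submodule (GA k n r) (LR k n r) where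
  carrier := {f | ∀ γ, f.coeff γ ≠ 0 → γ ∈ N}
  zero_mem' := by intro γ h; simp at h
  add_mem' {a b} ha hb := by
    intro γ h
    by_contra hN
    have h1 : a.coeff γ = 0 := by by_contra h'; exact hN (ha γ h')
    have h2 : b.coeff γ = 0 := by by_contra h'; exact hN (hb γ h')
    apply h; simp [h1, h2]
  smul_mem' t a ha := by
    intro γ h
    apply ha
    intro h'; apply h; simp [h']

lemma mem_sup {N : Set (Fin r → ℤ)} {f : LR k n r} : f ∈ sup k n N ↔ ∀ γ, f.coeff γ ≠ 0 → γ ∈ N := Iff.rfl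

lemma sup_mono {N N' : Set (Fin r → ℤ)} (h : N ⊆ N') {f : LR k n r} (hf : f ∈ sup k n N) : f ∈ sup k n N' :=
  fun γ hγ => h (hf γ hγ)

lemma mul_mem_sup {N N' N'' : Set (Fin r → ℤ)} (h : ∀ a ∈ N, ∀ b ∈ N', a + b ∈ N'')
    {f g : LR k n r} (hf : f ∈ sup k n N) (hg : g ∈ sup k n N') : f * g ∈ sup k n N'' := by
  classical
  intro γ hγ
  rw [AddMonoidAlgebra.coeff_mul, Finsupp.sum] at hγ
  obtain ⟨a, ha, h1⟩ := Finset.exists_ne_zero_of_sum_ne_zero hγ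
  rw [Finsupp.sum] at h1
  obtain ⟨b, hb, h2⟩ := Finset.exists_ne_zero_of_sum_ne_zero h1
  have hab : a + b = γ := by by_contra h3; simp [h3] at h2
  rw [← hab]
  exact h a (hf a (Finsupp.mem_support_iff.1 ha)) b (hg b (Finsupp.mem_support_iff.1 hb))

lemma T_mem_sup (γ : Fin r → ℤ) : T k n γ ∈ sup k n {γ} := by
  classical
  intro δ h
  by_contra h'
  apply h
  simp only [T, AddMonoidAlgebra.coeff_single]
  exact Finsupp.single_eq_of_ne h'

lemma theta_mem (c : Fin r → Bool) (f) : theta k n c f ∈ sup k n (Set.range (sgn c)) := by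
  classical
  intro γ h
  rw [theta_apply] at h
  have h1 : γ ∈ (Finsupp.mapDomain (sgn c) (AddMonoidAlgebra.coeff f)).support := Finsupp.mem_support_iff.2 h
  have h2 := Finsupp.mapDomain_support h1
  obtain ⟨x, _, hx⟩ := Finset.mem_image.1 h2
  exact ⟨x, hx⟩

lemma theta_surj (c : Fin r → Bool) (f) (hf : f ∈ sup k n (Set.range (sgn c))) : ∃ g, theta k n c g = f := by
  refine ⟨AddMonoidAlgebra.comapDomain (sgn c) (sgn_inj c) f, ?_⟩
  rw [theta_apply]
  exact AddMonoidAlgebra.mapDomain_comapDomain (fun γ hγ => hf γ (Finsupp.mem_support_iff.1 hγ)) _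

lemma mem_range_sgn (c : Fin r → Bool) (γ : Fin r → ℤ) :
    γ ∈ Set.range (sgn c) ↔ ∀ i, if c i then γ i ≤ 0 else 0 ≤ γ i := by
  constructor
  · rintro ⟨μ, rfl⟩ i
    rw [sgn_apply]
    split_ifs <;> omega
  · intro h
    refine ⟨Finsupp.equivFunOnFinite.symm fun i => (γ i).natAbs, ?_⟩
    ext i
    rw [sgn_apply]
    have := h i
    simp only [Finsupp.equivFunOnFinite_symm_apply_apply]
    split_ifs at * <;> omega

lemma Phi_mem (f : MvPolynomial (Fin n) k) (δ : ℤ) (hf : HD f δ) :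
    Phi k n r f ∈ sup k n {γ | ∀ i, 0 ≤ γ i ∧ γ i ≤ δ} := by
  have h : ∀ c : Fin r → Bool, Phi k n r f ∈ sup k n {γ | ∃ μ ∈ Set.range (sgn c), γ = δ • gam c + μ} := by
    intro c
    rw [Phi_eq c f δ hf]
    refine mul_mem_sup ?_ (T_mem_sup _) (theta_mem c _)
    rintro a rfl b hb
    exact ⟨b, hb, rfl⟩
  intro γ hγ i
  obtain ⟨μ, hμ, e⟩ := h (fun _ => false) γ hγ
  obtain ⟨ν, hν, e'⟩ := h (fun _ => true) γ hγ
  rw [mem_range_sgn] at hμ hν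
  have h1 := hμ i
  have h2 := hν i
  have e1 := congrFun e i
  have e2 := congrFun e' i
  simp [gam] at h1 h2 e1 e2
  omega

/-- chart condition -/
def Cnd {r : ℕ} (c : Fin r → Bool) (τ : Fin r → ℤ) (b : ℤ) : Set (Fin r → ℤ) :=
  {γ | ∀ i, if c i then γ i ≤ τ i - b else τ i ≤ γ i}

lemma lift_chart {α β γ : Type} [Fintype α] [Fintype β] [Fintype γ]
    (P : α → β → MvPolynomial (Fin n) k) (Q : β → γ → MvPolynomial (Fin n) k) (hex : Ex P Q)
    (a : α → ℤ) (b : β → ℤ) (g : γ → ℤ)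
    (hP : ∀ x y, HD (P x y) (b y - a x)) (hQ : ∀ y z, HD (Q y z) (g z - b y))
    (c : Fin r → Bool) (τ : Fin r → ℤ) (v : β → LR k n r)
    (hv : ∀ y, v y ∈ sup k n (Cnd c τ (b y)))
    (hPv : ∀ x, ∑ y, Phi k n r (P x y) * v y = 0) :
    ∃ w : γ → LR k n r, (∀ z, w z ∈ sup k n (Cnd c τ (g z))) ∧
      ∀ y, v y = ∑ z, Phi k n r (Q y z) * w z := by
  have h1 : ∀ y, ∃ v' , theta k n c v' = T k n (-(τ - b y • gam c)) * v y := by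
    intro y
    apply theta_surj
    refine mul_mem_sup ?_ (T_mem_sup _) (hv y)
    rintro _ rfl d hd
    rw [mem_range_sgn]
    intro i
    have := hd i
    simp only [Pi.add_apply, Pi.neg_apply, Pi.sub_apply, Pi.smul_apply, gam, smul_eq_mul]
    split_ifs at * <;> simp <;> omega
  choose v' hv' using h1
  have hvv : ∀ y, v y = T k n (τ - b y • gam c) * theta k n c (v' y) := by
    intro y
    rw [hv', ← mul_assoc, ← T_add, add_neg_cancel, T_zero, one_mul]
  have hz : ∀ x, ∑ y, phiC k n c (P x y) * v' y = 0 := by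
    intro x
    apply theta_inj (k := k) (n := n) c
    have h2 := hPv x
    have h3 : ∑ y, Phi k n r (P x y) * v y =
        T k n (τ - a x • gam c) * theta k n c (∑ y, phiC k n c (P x y) * v' y) := by
      rw [map_sum, Finset.mul_sum]
      refine Finset.sum_congr rfl fun y _ => ?_
      rw [Phi_eq c _ _ (hP x y), hvv y, map_mul]
      have : τ - a x • gam c = (b y - a x) • gam c + (τ - b y • gam c) := by
        rw [sub_smul]; abel
      rw [this, T_add]; ring
    rw [h3] at h2
    have h4 := congrArg (fun t => T k n (-(τ - a x • gam c)) * t) h2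
    simp only [← mul_assoc, ← T_add, neg_add_cancel, T_zero, one_mul, mul_zero] at h4
    rw [h4, map_zero]
  obtain ⟨w', hw'⟩ := flat_exact (phiC k n c) (phiC_flat c) P Q hex v' hz
  refine ⟨fun z => T k n (τ - g z • gam c) * theta k n c (w' z), fun z => ?_, fun y => ?_⟩
  · refine mul_mem_sup ?_ (T_mem_sup _) (theta_mem c _)
    rintro _ rfl d hd
    rw [mem_range_sgn] at hd
    intro i
    have := hd i
    simp only [Pi.add_apply, Pi.sub_apply, Pi.smul_apply, gam, smul_eq_mul]
    split_ifs at * <;> simp <;> omega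
  · rw [hvv y, hw' y, map_sum, Finset.mul_sum]
    refine Finset.sum_congr rfl fun z _ => ?_
    rw [Phi_eq c _ _ (hQ y z), map_mul]
    have : τ - b y • gam c = (g z - b y) • gam c + (τ - g z • gam c) := by
      rw [sub_smul]; abel
    rw [this, T_add]; ring

lemma mulVec_mem {α β : Type} [Fintype β]
    (P : α → β → MvPolynomial (Fin n) k) (a : α → ℤ) (b : β → ℤ)
    (hP : ∀ x y, HD (P x y) (b y - a x)) (N : ℤ → Set (Fin r → ℤ))
    (hN : ∀ s t : ℤ, ∀ μ γ : Fin r → ℤ, (∀ i, 0 ≤ μ i ∧ μ i ≤ t - s) → γ ∈ N t → μ + γ ∈ N s)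
    (v : β → LR k n r) (hv : ∀ y, v y ∈ sup k n (N (b y))) (x : α) :
    ∑ y, Phi k n r (P x y) * v y ∈ sup k n (N (a x)) := by
  refine Submodule.sum_mem _ fun y _ => mul_mem_sup ?_ (Phi_mem _ _ (hP x y)) (hv y)
  intro μ hμ γ hγ
  exact hN _ _ μ γ hμ hγ

lemma exists_lb {β : Type} [Fintype β] (v : β → LR k n r) :
    ∃ N : ℤ, ∀ y, v y ∈ sup k n {γ | ∀ i, N ≤ γ i} := by
  classical
  have h1 : ∃ N : ℤ, ∀ y ∈ (Finset.univ : Finset β), ∀ γ ∈ (v y).coeff.support, ∀ i ∈ (Finset.univ : Finset (Fin r)), N ≤ γ i := by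
    let s : Finset ℤ := Finset.univ.biUnion fun y => (v y).coeff.support.biUnion fun γ => Finset.univ.image γ
    obtain ⟨N, hN⟩ := s.bddBelow
    refine ⟨N, fun y _ γ hγ i _ => hN ?_⟩
    simp only [s, Finset.coe_biUnion, Set.mem_iUnion]
    exact ⟨y, by simp, γ, hγ, by simp⟩
  obtain ⟨N, hN⟩ := h1
  exact ⟨N, fun y γ hγ i => hN y (Finset.mem_univ _) γ (Finsupp.mem_support_iff.2 hγ) i (Finset.mem_univ _)⟩

/-- projection to the part supported in `N` -/
noncomputable def prj (k : Type) [Field k] (n : ℕ) {r : ℕ} (N : Set (Fin r → ℤ)) : LR k n r →ₗ[GA k n r] LR k n r := by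
  classical
  exact
  { toFun := fun f => AddMonoidAlgebra.ofCoeff (f.coeff.filter (· ∈ N))
    map_add' := by
      intro f g
      ext γ
      by_cases h : γ ∈ N <;> simp [h]
    map_smul' := by
      intro t g
      ext γ
      by_cases h : γ ∈ N <;> simp [h] }

lemma prj_coeff_mem {N : Set (Fin r → ℤ)} {γ} (h : γ ∈ N) (f : LR k n r) : (prj k n N f).coeff γ = f.coeff γ := by
  classical
  simp [prj, h]

lemma prj_coeff_not {N : Set (Fin r → ℤ)} {γ} (h : γ ∉ N) (f : LR k n r) : (prj k n N f).coeff γ = 0 := by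
  classical
  simp [prj, h]

lemma prj_mem (N : Set (Fin r → ℤ)) (f : LR k n r) : prj k n N f ∈ sup k n N := by
  intro γ h
  by_contra h'
  exact h (prj_coeff_not h' f)

lemma sub_prj_mem (N N' : Set (Fin r → ℤ)) (f : LR k n r) (hf : f ∈ sup k n N') : f - prj k n N f ∈ sup k n (N' \ N) := by
  intro γ h
  by_cases h' : γ ∈ N
  · exfalso; apply h
    have : (f - prj k n N f).coeff γ = f.coeff γ - (prj k n N f).coeff γ := rfl
    rw [this, prj_coeff_mem h', sub_self]
  · refine ⟨?_, h'⟩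
    apply hf
    intro h2; apply h
    have : (f - prj k n N f).coeff γ = f.coeff γ - (prj k n N f).coeff γ := rfl
    rw [this, prj_coeff_not h', h2, sub_self]

lemma prj_mem_of (N N' : Set (Fin r → ℤ)) (f : LR k n r) (hf : f ∈ sup k n N') : prj k n N f ∈ sup k n (N' ∩ N) := by
  intro γ h
  by_cases h' : γ ∈ N
  · rw [prj_coeff_mem h'] at h; exact ⟨hf γ h, h'⟩
  · exact absurd (prj_coeff_not h' f) h

lemma eq_zero_of_disj {N N' : Set (Fin r → ℤ)} (h : ∀ γ ∈ N, γ ∉ N') {f : LR k n r}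
    (h1 : f ∈ sup k n N) (h2 : f ∈ sup k n N') : f = 0 := by
  apply AddMonoidAlgebra.coeff_injective
  refine Finsupp.ext fun γ => ?_
  by_contra h3
  exact h γ (h1 γ h3) (h2 γ h3)

end

section
variable {k : Type} [Field k] {n r : ℕ}

/-- coordinate half space -/
def H1 {r : ℕ} (i : Fin r) (s : Bool) (τ b : ℤ) : Set (Fin r → ℤ) :=
  {γ | if s then γ i ≤ τ - b else τ ≤ γ i}

lemma H1_false {i : Fin r} {τ b : ℤ} {γ : Fin r → ℤ} : γ ∈ H1 i false τ b ↔ τ ≤ γ i := by simp [H1]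
lemma H1_true {i : Fin r} {τ b : ℤ} {γ : Fin r → ℤ} : γ ∈ H1 i true τ b ↔ γ i ≤ τ - b := by simp [H1]

lemma H1_pres (i : Fin r) (s : Bool) (τ : ℤ) (a b : ℤ) (μ γ : Fin r → ℤ)
    (hμ : ∀ i, 0 ≤ μ i ∧ μ i ≤ b - a) (hγ : γ ∈ H1 i s τ b) : μ + γ ∈ H1 i s τ a := by
  have := hμ i
  cases s
  · rw [H1_false] at *; simp only [Pi.add_apply]; omega
  · rw [H1_true] at *; simp only [Pi.add_apply]; omega

/-- matrix action -/
noncomputable def mv (r : ℕ) {α β : Type} [Fintype β] (P : α → β → MvPolynomial (Fin n) k) :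
    (β → LR k n r) →ₗ[GA k n r] (α → LR k n r) where
  toFun v x := ∑ y, Phi k n r (P x y) * v y
  map_add' v w := by ext1 x; simp [mul_add, Finset.sum_add_distrib]
  map_smul' t v := by ext1 x; simp [Finset.smul_sum]

lemma mv_apply {α β : Type} [Fintype β] (P : α → β → MvPolynomial (Fin n) k) (v : β → LR k n r) (x : α) :
  mv r P v x = ∑ y, Phi k n r (P x y) * v y := rfl

lemma mv_mv {α β γ : Type} [Fintype β] [Fintype γ] (P : α → β → MvPolynomial (Fin n) k)
    (Q : β → γ → MvPolynomial (Fin n) k) (h : ∀ x z, ∑ y, P x y * Q y z = 0) (v : γ → LR k n r) :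
    mv r P (mv r Q v) = 0 := by
  ext1 x
  simp only [mv_apply, Finset.mul_sum, Pi.zero_apply]
  rw [Finset.sum_comm]
  refine Finset.sum_eq_zero fun z _ => ?_
  have : ∑ y, Phi k n r (P x y) * (Phi k n r (Q y z) * v z) = Phi k n r (∑ y, P x y * Q y z) * v z := by
    rw [map_sum, Finset.sum_mul]
    refine Finset.sum_congr rfl fun y _ => ?_
    rw [map_mul, mul_assoc]
  rw [this, h, map_zero, zero_mul]

/-- vector with supports in a degree-dependent set -/
def Vs {β : Type} (N : ℤ → Set (Fin r → ℤ)) (b : β → ℤ) : Submodule (GA k n r) (β → LR k n r) where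
  carrier := {v | ∀ y, v y ∈ sup k n (N (b y))}
  zero_mem' := fun _ => Submodule.zero_mem _
  add_mem' h1 h2 := fun y => Submodule.add_mem _ (h1 y) (h2 y)
  smul_mem' t _ h := fun y => Submodule.smul_mem _ t (h y)

lemma mem_Vs {β : Type} {N : ℤ → Set (Fin r → ℤ)} {b : β → ℤ} {v : β → LR k n r} :
    v ∈ Vs N b ↔ ∀ y, v y ∈ sup k n (N (b y)) := Iff.rfl

lemma Vs_mono {β : Type} {N N' : ℤ → Set (Fin r → ℤ)} {b : β → ℤ} {v : β → LR k n r}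
    (hv : v ∈ Vs N b) (h : ∀ y, N (b y) ⊆ N' (b y)) : v ∈ Vs N' b :=
  fun y => sup_mono (h y) (hv y)

def Pres {r : ℕ} (N : ℤ → Set (Fin r → ℤ)) : Prop :=
  ∀ s t : ℤ, ∀ μ γ : Fin r → ℤ, (∀ i, 0 ≤ μ i ∧ μ i ≤ t - s) → γ ∈ N t → μ + γ ∈ N s

lemma mv_mem {α β : Type} [Fintype β]
    {P : α → β → MvPolynomial (Fin n) k} {a : α → ℤ} {b : β → ℤ}
    (hP : ∀ x y, HD (P x y) (b y - a x)) {N : ℤ → Set (Fin r → ℤ)}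
    (hN : Pres N) {v : β → LR k n r} (hv : v ∈ Vs N b) : mv r P v ∈ Vs N a :=
  fun x => mulVec_mem P a b hP N hN v hv x

noncomputable def prjV {β : Type} (N : ℤ → Set (Fin r → ℤ)) (b : β → ℤ) :
    (β → LR k n r) →ₗ[GA k n r] (β → LR k n r) where
  toFun v y := prj k n (N (b y)) (v y)
  map_add' v w := by ext1 x; simp
  map_smul' t v := by ext1 x; simp

lemma prjV_mem {β : Type} (N : ℤ → Set (Fin r → ℤ)) (b : β → ℤ) (v : β → LR k n r) :
    prjV N b v ∈ Vs N b := fun _ => prj_mem _ _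

lemma prjV_mem_of {β : Type} (N : ℤ → Set (Fin r → ℤ)) {N' : ℤ → Set (Fin r → ℤ)} {b : β → ℤ} {v : β → LR k n r}
    (hv : v ∈ Vs N' b) : prjV N b v ∈ Vs (fun t => N' t ∩ N t) b := fun y => prj_mem_of _ _ _ (hv y)

lemma sub_prjV_mem {β : Type} (N : ℤ → Set (Fin r → ℤ)) {N' : ℤ → Set (Fin r → ℤ)} {b : β → ℤ} {v : β → LR k n r}
    (hv : v ∈ Vs N' b) : v - prjV N b v ∈ Vs (fun t => N' t \ N t) b := fun y => sub_prj_mem _ _ _ (hv y)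

lemma eq_zero_V {β : Type} {N N' : ℤ → Set (Fin r → ℤ)} {b : β → ℤ} (h : ∀ y, ∀ γ ∈ N (b y), γ ∉ N' (b y))
    {v : β → LR k n r} (h1 : v ∈ Vs N b) (h2 : v ∈ Vs N' b) : v = 0 := by
  ext1 y
  exact eq_zero_of_disj (h y) (h1 y) (h2 y)

lemma univ_mem {β : Type} (b : β → ℤ) (v : β → LR k n r) : v ∈ Vs (fun _ => Set.univ) b :=
  fun _ _ _ => trivial

lemma lift_c {α β γ : Type} [Fintype α] [Fintype β] [Fintype γ]
    {P : α → β → MvPolynomial (Fin n) k} {Q : β → γ → MvPolynomial (Fin n) k} (hex : Ex P Q)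
    {a : α → ℤ} {b : β → ℤ} {g : γ → ℤ}
    (hP : ∀ x y, HD (P x y) (b y - a x)) (hQ : ∀ y z, HD (Q y z) (g z - b y))
    (c : Fin r → Bool) (τ : Fin r → ℤ) {v : β → LR k n r}
    (hv : v ∈ Vs (Cnd c τ) b) (hPv : mv r P v = 0) :
    ∃ w ∈ Vs (Cnd c τ) g, v = mv r Q w := by
  obtain ⟨w, h1, h2⟩ := lift_chart P Q hex a b g hP hQ c τ v hv (fun x => congrFun hPv x)
  exact ⟨w, h1, funext h2⟩

lemma lift_0 {α β γ : Type} [Fintype α] [Fintype β] [Fintype γ]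
    {P : α → β → MvPolynomial (Fin n) k} {Q : β → γ → MvPolynomial (Fin n) k} (hex : Ex P Q)
    {a : α → ℤ} {b : β → ℤ} {g : γ → ℤ}
    (hP : ∀ x y, HD (P x y) (b y - a x)) (hQ : ∀ y z, HD (Q y z) (g z - b y))
    {v : β → LR k n r} (hPv : mv r P v = 0) : ∃ w, v = mv r Q w := by
  obtain ⟨N, hN⟩ := exists_lb v
  obtain ⟨w, _, h⟩ := lift_c hex hP hQ (fun _ => false) (fun _ => N) (v := v)
    (fun y => sup_mono (fun γ hγ i => by simpa using hγ i) (hN y)) hPv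
  exact ⟨w, h⟩

lemma lift_1 {α β γ : Type} [Fintype α] [Fintype β] [Fintype γ]
    {P : α → β → MvPolynomial (Fin n) k} {Q : β → γ → MvPolynomial (Fin n) k} (hex : Ex P Q)
    {a : α → ℤ} {b : β → ℤ} {g : γ → ℤ}
    (hP : ∀ x y, HD (P x y) (b y - a x)) (hQ : ∀ y z, HD (Q y z) (g z - b y))
    (i : Fin r) (s : Bool) (τ : ℤ)
    {v : β → LR k n r} (hv : v ∈ Vs (H1 i s τ) b) (hPv : mv r P v = 0) :
    ∃ w ∈ Vs (H1 i s τ) g, v = mv r Q w := by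
  obtain ⟨N, hN⟩ := exists_lb v
  obtain ⟨w, hw, h⟩ := lift_c hex hP hQ (fun j => if j = i then s else false) (fun j => if j = i then τ else N) (v := v)
    (fun y γ hγ j => by
      have h1 := hv y γ hγ
      have h2 := hN y γ hγ j
      by_cases hj : j = i
      · subst hj; simpa [H1] using h1
      · simpa [hj] using h2) hPv
  refine ⟨w, fun z γ hγ => ?_, h⟩
  have := hw z γ hγ i
  simpa [H1] using this

/-- embedding of a finite box -/
noncomputable def inc {β : Type} [Fintype β] {E : β → Type} [∀ y, Fintype (E y)] (e : ∀ y, E y → (Fin r → ℤ)) :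
    (((y : β) × E y) → GA k n r) →ₗ[GA k n r] (β → LR k n r) where
  toFun x y := ∑ i, AddMonoidAlgebra.single (e y i) (x ⟨y, i⟩)
  map_add' v w := by
    ext1 y; simp only [Pi.add_apply, AddMonoidAlgebra.single_add, Finset.sum_add_distrib]
  map_smul' t v := by
    ext1 y; simp [Finset.smul_sum, AddMonoidAlgebra.smul_single]

noncomputable def red {β : Type} {E : β → Type} (e : ∀ y, E y → (Fin r → ℤ)) :
    (β → LR k n r) →ₗ[GA k n r] (((y : β) × E y) → GA k n r) where
  toFun w p := (w p.1).coeff (e p.1 p.2)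
  map_add' v w := by ext1 y; simp
  map_smul' t v := by ext1 y; simp

lemma inc_mem {β : Type} [Fintype β] {E : β → Type} [∀ y, Fintype (E y)] (e : ∀ y, E y → (Fin r → ℤ))
    (x : ((y : β) × E y) → GA k n r) (y : β) : inc e x y ∈ sup k n (Set.range (e y)) := by
  classical
  refine Submodule.sum_mem _ fun i _ γ hγ => ?_
  rw [AddMonoidAlgebra.coeff_single] at hγ
  refine ⟨i, ?_⟩
  by_contra h
  exact hγ (Finsupp.single_eq_of_ne (Ne.symm h))

lemma red_inc {β : Type} [Fintype β] {E : β → Type} [∀ y, Fintype (E y)] (e : ∀ y, E y → (Fin r → ℤ))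
    (he : ∀ y, Function.Injective (e y)) (x : ((y : β) × E y) → GA k n r) : red e (inc e x) = x := by
  classical
  refine funext fun ⟨y, i⟩ => ?_
  change (∑ i', AddMonoidAlgebra.single (e y i') (x ⟨y, i'⟩)).coeff (e y i) = _
  rw [AddMonoidAlgebra.coeff_sum, Finsupp.finsetSum_apply, Finset.sum_eq_single i]
  · rw [AddMonoidAlgebra.coeff_single, Finsupp.single_eq_same]
  · intro j _ hj
    rw [AddMonoidAlgebra.coeff_single]
    exact Finsupp.single_eq_of_ne fun h => hj (he y h.symm)
  · simp

lemma red_eq_zero {β : Type} {E : β → Type} (e : ∀ y, E y → (Fin r → ℤ)) {w : β → LR k n r}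
    (h : ∀ y, w y ∈ sup k n (Set.range (e y))ᶜ) : red e w = 0 := by
  refine funext fun ⟨y, i⟩ => ?_
  by_contra h'
  exact h y _ h' ⟨i, rfl⟩

lemma mem_of_red_eq_zero {β : Type} {E : β → Type} (e : ∀ y, E y → (Fin r → ℤ)) {w : β → LR k n r}
    (h : red e w = 0) (y : β) : w y ∈ sup k n (Set.range (e y))ᶜ := by
  rintro γ hγ ⟨i, rfl⟩
  exact hγ (congrFun h ⟨y, i⟩)

lemma rank_count (A : Type) [CommRing A] [IsDomain A] {E2 E3 D : Type} [Fintype E2] [Fintype E3] [Fintype D]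
    (H : (E2 → A) →ₗ[A] (D → A)) (ψ : (E3 → A) →ₗ[A] (E2 → A))
    (h : ∀ x, H x = 0 → ∃ z, ψ z = x) : Fintype.card E2 ≤ Fintype.card D + Fintype.card E3 := by
  have h1 := LinearMap.rank_range_add_rank_ker H
  have h2 : LinearMap.ker H ≤ LinearMap.range ψ := fun x hx => h x hx
  have h3 : Module.rank A (LinearMap.ker H) ≤ Fintype.card E3 := by
    refine (Submodule.rank_mono h2).trans ((rank_range_le ψ).trans ?_)
    rw [rank_fun']
  have h4 : Module.rank A (LinearMap.range H) ≤ Fintype.card D := by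
    refine (Submodule.rank_le _).trans ?_
    rw [rank_fun']
  rw [rank_fun'] at h1
  have h5 : ((Fintype.card E2 : ℕ) : Cardinal) ≤ ((Fintype.card D + Fintype.card E3 : ℕ) : Cardinal) := by
    rw [← h1]; push_cast; exact add_le_add h4 h3
  exact_mod_cast h5

end

/-- matrices of a length three complex; `κ`, `lam` are the excess degrees over `d` -/
structure Dat (k : Type) [Field k] (n d : ℕ) (A1 A2 A3 : Type) [Fintype A1] [Fintype A2] [Fintype A3] where
  f : Unit → A1 → MvPolynomial (Fin n) k
  M : A1 → A2 → MvPolynomial (Fin n) k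
  L : A2 → A3 → MvPolynomial (Fin n) k
  κ : A2 → ℕ
  lam : A3 → ℕ
  hf : ∀ x y, HD (f x y) ((d : ℤ) - 0)
  hM : ∀ x y, HD (M x y) (((d + κ y : ℕ) : ℤ) - d)
  hL : ∀ x y, HD (L x y) (((d + lam y : ℕ) : ℤ) - ((d + κ x : ℕ) : ℤ))
  fM : ∀ x z, ∑ y, f x y * M y z = 0
  ML : ∀ x z, ∑ y, M x y * L y z = 0
  ex1 : Ex f M
  ex2 : Ex M L
  ex3 : Ex L (fun (_ : A3) (_ : Empty) => 0)

section
variable {k : Type} [Field k] {n d : ℕ} {A1 A2 A3 : Type} [Fintype A1] [Fintype A2] [Fintype A3]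

namespace Dat
variable (D : Dat k n d A1 A2 A3)

def b0 (_ : Dat k n d A1 A2 A3) : Unit → ℤ := fun _ => 0
def b1 (_ : Dat k n d A1 A2 A3) : A1 → ℤ := fun _ => d
def b2 : A2 → ℤ := fun y => ((d + D.κ y : ℕ) : ℤ)
def b3 : A3 → ℤ := fun y => ((d + D.lam y : ℕ) : ℤ)

lemma Hf : ∀ x y, HD (D.f x y) (D.b1 y - D.b0 x) := D.hf
lemma HM : ∀ x y, HD (D.M x y) (D.b2 y - D.b1 x) := D.hM
lemma HL : ∀ x y, HD (D.L x y) (D.b3 y - D.b2 x) := D.hL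

lemma L_inj {r : ℕ} {v : A3 → LR k n r} (hv : mv r D.L v = 0) : v = 0 := by
  obtain ⟨w, hw⟩ := lift_0 D.ex3 (g := fun _ => 0) D.HL (fun _ _ => Or.inl rfl) hv
  rw [hw]; ext1 y; simp [mv_apply]

end Dat

def eC {β : Type} (κ : β → ℕ) (y : β) : Fin (κ y) → (Fin 1 → ℤ) := fun i _ => -1 - (i : ℕ)

lemma eC_inj {β : Type} (κ : β → ℕ) (y : β) : Function.Injective (eC κ y) := by
  intro i j h
  have := congrFun h 0
  simp only [eC] at this
  ext; omega

lemma mem_eC {β : Type} (κ : β → ℕ) (y : β) (γ : Fin 1 → ℤ) :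
    γ ∈ Set.range (eC κ y) ↔ γ 0 ≤ -1 ∧ -(κ y : ℤ) ≤ γ 0 := by
  constructor
  · rintro ⟨i, rfl⟩
    have := i.2
    simp only [eC]; omega
  · rintro ⟨h1, h2⟩
    refine ⟨⟨(-1 - γ 0).toNat, by omega⟩, ?_⟩
    ext j
    obtain rfl : j = 0 := Subsingleton.elim _ _
    simp only [eC]; omega

/-- complement of the box -/
def outC (d : ℕ) (t : ℤ) : Set (Fin 1 → ℤ) := {γ | 0 ≤ γ 0 ∨ γ 0 ≤ d - 1 - t}

lemma outC_pres : Pres (outC d) := by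
  intro s t μ γ hμ hγ
  have := hμ 0
  simp only [outC, Set.mem_ofPred_eq, Pi.add_apply] at *
  omega

theorem ineqC (D : Dat k n d A1 A2 A3) : ∑ y, D.κ y ≤ d + ∑ z, D.lam z := by
  classical
  have hcompl2 : ∀ y, (Set.range (eC D.κ y))ᶜ = outC d (D.b2 y) := by
    intro y; ext γ
    rw [Set.mem_compl_iff, mem_eC]; simp only [outC, Set.mem_ofPred_eq, Dat.b2]; push_cast; omega
  have hcompl3 : ∀ y, (Set.range (eC D.lam y))ᶜ = outC d (D.b3 y) := by
    intro y; ext γ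
    rw [Set.mem_compl_iff, mem_eC]; simp only [outC, Set.mem_ofPred_eq, Dat.b3]; push_cast; omega
  let U0 : ℤ → Set (Fin 1 → ℤ) := H1 0 false 0
  let Ui : ℤ → Set (Fin 1 → ℤ) := H1 0 true (d - 1)
  have pU0 : Pres U0 := H1_pres 0 false 0
  have pUi : Pres Ui := H1_pres 0 true (d - 1)
  let cf : (Unit → LR k n 1) →ₗ[GA k n 1] (((_ : Unit) × Fin d) → GA k n 1) :=
    red (fun _ (j : Fin d) _ => ((j : ℕ) : ℤ))
  let ψ := (red (k := k) (n := n) (eC D.κ)) ∘ₗ (mv 1 D.L) ∘ₗ (inc (eC D.lam))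
  let H := cf ∘ₗ (mv 1 D.f) ∘ₗ (prjV U0 D.b1) ∘ₗ (mv 1 D.M) ∘ₗ (inc (eC D.κ))
  have key : ∀ x, H x = 0 → ∃ z, ψ z = x := by
    intro x hx
    set w := inc (k := k) (n := n) (eC D.κ) x with hw
    set v := mv 1 D.M w with hv
    set v0 := prjV U0 D.b1 v with hv0
    have hx' : cf (mv 1 D.f v0) = 0 := hx
    have m0 : v0 ∈ Vs U0 D.b1 := prjV_mem _ _ _
    have mi : v - v0 ∈ Vs Ui D.b1 := by
      refine Vs_mono (sub_prjV_mem U0 (univ_mem D.b1 v)) fun y γ hγ => ?_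
      have := hγ.2
      simp only [U0, Ui, H1_false, H1_true, Dat.b1] at *
      omega
    have fv : mv 1 D.f v = 0 := mv_mv _ _ D.fM w
    have e1 : mv 1 D.f v0 = - mv 1 D.f (v - v0) := by rw [map_sub, fv]; simp
    have n0 : mv 1 D.f v0 ∈ Vs U0 D.b0 := mv_mem D.Hf pU0 m0
    have ni : mv 1 D.f v0 ∈ Vs Ui D.b0 := by
      rw [e1]; exact Submodule.neg_mem _ (mv_mem D.Hf pUi mi)
    have fv0 : mv 1 D.f v0 = 0 := by
      ext1 u
      refine eq_zero_of_disj ?_ (n0 u) (fun γ hγ => ⟨ni u γ hγ, mem_of_red_eq_zero _ hx' u γ hγ⟩ :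
        mv 1 D.f v0 u ∈ sup k n (Ui (D.b0 u) ∩ (Set.range (fun (j : Fin d) _ => ((j : ℕ) : ℤ)))ᶜ))
      rintro γ h1 ⟨h2, h3⟩
      apply h3
      simp only [U0, Ui, H1_false, H1_true, Dat.b0] at *
      refine ⟨⟨(γ 0).toNat, by omega⟩, ?_⟩
      ext j
      obtain rfl : j = 0 := Subsingleton.elim _ _
      simp only []; omega
    have fvi : mv 1 D.f (v - v0) = 0 := by rw [map_sub, fv, fv0, sub_zero]
    obtain ⟨y0, my0, ey0⟩ := lift_1 D.ex1 D.Hf D.HM 0 false 0 m0 fv0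
    obtain ⟨yi, myi, eyi⟩ := lift_1 D.ex1 D.Hf D.HM 0 true (d - 1) mi fvi
    have hM0 : mv 1 D.M (w - y0 - yi) = 0 := by
      rw [map_sub, map_sub, ← ey0, ← eyi]; simp [hv]
    obtain ⟨z, hz⟩ := lift_0 D.ex2 D.HM D.HL hM0
    refine ⟨red (eC D.lam) z, ?_⟩
    have s1 : red (eC D.κ) (mv 1 D.L z) = x := by
      rw [← hz, map_sub, map_sub, hw, red_inc _ (eC_inj _)]
      rw [red_eq_zero (w := y0), red_eq_zero (w := yi)]
      · simp
      · intro y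
        rw [hcompl2]
        refine sup_mono (fun γ hγ => ?_) (myi y)
        rw [H1_true] at hγ
        simp only [outC, Set.mem_ofPred_eq]; omega
      · intro y
        rw [hcompl2]
        refine sup_mono (fun γ hγ => ?_) (my0 y)
        rw [H1_false] at hγ
        simp only [outC, Set.mem_ofPred_eq]; omega
    have s2 : z - inc (eC D.lam) (red (eC D.lam) z) ∈ Vs (outC d) D.b3 := by
      intro y
      rw [← hcompl3]
      apply mem_of_red_eq_zero
      rw [map_sub, red_inc _ (eC_inj _), sub_self]
    have s3 : red (eC D.κ) (mv 1 D.L (z - inc (eC D.lam) (red (eC D.lam) z))) = 0 := by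
      apply red_eq_zero
      intro y
      rw [hcompl2]
      exact mv_mem D.HL outC_pres s2 y
    rw [map_sub, map_sub, s1, sub_eq_zero] at s3
    exact s3.symm
  have := rank_count (GA k n 1) H ψ key
  simpa using this

end

section
variable {k : Type} [Field k] {n d : ℕ} {A1 A2 A3 : Type} [Fintype A1] [Fintype A2] [Fintype A3]

def eD {β : Type} (d : ℕ) (κ m : β → ℕ) (y : β) : Fin (d + κ y) × Fin (m y) → (Fin 2 → ℤ) :=
  fun i => ![-1 - (i.1 : ℕ), -1 - (i.2 : ℕ)]

lemma eD_inj {β : Type} (κ m : β → ℕ) (y : β) : Function.Injective (eD d κ m y) := by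
  intro i j h
  have h0 := congrFun h 0
  have h1 := congrFun h 1
  simp [eD] at h0 h1
  ext <;> omega

lemma mem_eD {β : Type} (κ m : β → ℕ) (y : β) (γ : Fin 2 → ℤ) :
    γ ∈ Set.range (eD d κ m y) ↔ (γ 0 ≤ -1 ∧ -((d + κ y : ℕ) : ℤ) ≤ γ 0) ∧ (γ 1 ≤ -1 ∧ -(m y : ℤ) ≤ γ 1) := by
  constructor
  · rintro ⟨i, rfl⟩
    have := i.1.2
    have := i.2.2
    simp [eD]; omega
  · rintro ⟨⟨h1, h2⟩, h3, h4⟩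
    refine ⟨(⟨(-1 - γ 0).toNat, by omega⟩, ⟨(-1 - γ 1).toNat, by omega⟩), ?_⟩
    ext j
    fin_cases j
    · simp [eD]; omega
    · simp [eD]; omega

/-- complement of the box -/
def outD (d : ℕ) (t : ℤ) : Set (Fin 2 → ℤ) :=
  {γ | (0 ≤ γ 0 ∨ γ 0 ≤ -1 - t) ∨ (0 ≤ γ 1 ∨ γ 1 ≤ d - 1 - t)}

theorem ineqD (D : Dat k n d A1 A2 A3) (Y : A2 → Prop) (Z : A3 → Prop) [DecidablePred Y] [DecidablePred Z]
    (hYZ : ∀ y z, Z z → ¬ Y y → D.L y z = 0) :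
    ∑ z, (d + D.lam z) * (if Z z then D.lam z else 0) ≤ ∑ y, (d + D.κ y) * (if Y y then D.κ y else 0) := by
  classical
  let mY : A2 → ℕ := fun y => if Y y then D.κ y else 0
  let mZ : A3 → ℕ := fun z => if Z z then D.lam z else 0
  let S0 : ℤ → Set (Fin 2 → ℤ) := H1 0 false 0
  let Si : ℤ → Set (Fin 2 → ℤ) := H1 0 true (-1)
  let U0 : ℤ → Set (Fin 2 → ℤ) := H1 1 false 0
  let Ui : ℤ → Set (Fin 2 → ℤ) := H1 1 true (d - 1)
  have pS0 : Pres S0 := H1_pres 0 false 0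
  have pSi : Pres Si := H1_pres 0 true (-1)
  have pU0 : Pres U0 := H1_pres 1 false 0
  have pUi : Pres Ui := H1_pres 1 true (d - 1)
  let ψ := (red (k := k) (n := n) (eD d D.κ mY)) ∘ₗ (mv 2 D.L) ∘ₗ (inc (eD d D.lam mZ))
  have key : ∀ x, ψ x = 0 → x = 0 := by
    intro x hx
    set z := inc (k := k) (n := n) (eD d D.lam mZ) x with hz
    have hz0 : ∀ t, ¬ Z t → z t = 0 := by
      intro t ht
      refine eq_zero_of_disj (N' := ∅) (fun _ _ h => h) (inc_mem _ x t) (sup_mono ?_ (inc_mem _ x t))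
      intro γ hγ
      rw [mem_eD] at hγ
      simp only [mZ, if_neg ht] at hγ
      exfalso; push_cast at hγ; omega
    set g := mv 2 D.L z with hg
    have gout : g ∈ Vs (outD d) D.b2 := by
      intro y
      by_cases hy : Y y
      · refine sup_mono ?_ (mem_of_red_eq_zero (eD d D.κ mY) hx y)
        intro γ hγ
        rw [Set.mem_compl_iff, mem_eD] at hγ
        simp only [mY, if_pos hy, outD, Set.mem_ofPred_eq, Dat.b2] at *
        push_cast at *
        omega
      · have : g y = 0 := by
          rw [hg, mv_apply]
          refine Finset.sum_eq_zero fun t _ => ?_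
          by_cases ht : Z t
          · rw [hYZ y t ht hy, map_zero, zero_mul]
          · rw [hz0 t ht, mul_zero]
        rw [this]; exact Submodule.zero_mem _
    -- split
    set p := prjV S0 D.b2 g with hp
    have mp : p ∈ Vs S0 D.b2 := prjV_mem _ _ _
    have m1 := sub_prjV_mem S0 gout
    set g1 := g - p with hg1
    set q := prjV Si D.b2 g1 with hq
    have mq : q ∈ Vs Si D.b2 := prjV_mem _ _ _
    have m2 := sub_prjV_mem Si m1
    set g2 := g1 - q with hg2
    set w0 := prjV U0 D.b2 g2 with hw0
    have mw0 : w0 ∈ Vs U0 D.b2 := prjV_mem _ _ _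
    have mwi : g2 - w0 ∈ Vs Ui D.b2 := by
      refine Vs_mono (sub_prjV_mem U0 m2) fun y γ hγ => ?_
      obtain ⟨⟨⟨h1, h2⟩, h3⟩, h4⟩ := hγ
      simp only [outD, Set.mem_ofPred_eq, S0, Si, U0, Ui, H1_false, H1_true] at *
      omega
    set wi := g2 - w0 with hwi
    have gsum : g = p + q + w0 + wi := by rw [hwi, hg2, hg1]; abel
    have Mg : mv 2 D.M g = 0 := mv_mv _ _ D.ML z
    have splitU : ∀ (N : ℤ → Set (Fin 2 → ℤ)) (v : A1 → LR k n 2), v ∈ Vs N D.b1 →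
        ∃ v0 vi, v = v0 + vi ∧ v0 ∈ Vs (fun t => N t ∩ U0 t) D.b1 ∧ vi ∈ Vs (fun t => N t ∩ Ui t) D.b1 := by
      intro N v hv
      refine ⟨prjV U0 D.b1 v, v - prjV U0 D.b1 v, by abel, prjV_mem_of _ hv, ?_⟩
      refine Vs_mono (sub_prjV_mem U0 hv) fun y γ hγ => ⟨hγ.1, ?_⟩
      have := hγ.2
      simp only [U0, Ui, H1_false, H1_true, Dat.b1] at *
      omega
    obtain ⟨v0, vi, ev, mv0, mvi⟩ := splitU S0 _ (mv_mem D.HM pS0 mp)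
    obtain ⟨v0', vi', ev', mv0', mvi'⟩ := splitU Si _ (mv_mem D.HM pSi mq)
    have toU0 : ∀ {N : ℤ → Set (Fin 2 → ℤ)} {v : A1 → LR k n 2},
        v ∈ Vs (fun t => N t ∩ U0 t) D.b1 → v ∈ Vs U0 D.b1 := fun h => Vs_mono h fun _ _ hγ => hγ.2
    have toUi : ∀ {N : ℤ → Set (Fin 2 → ℤ)} {v : A1 → LR k n 2},
        v ∈ Vs (fun t => N t ∩ Ui t) D.b1 → v ∈ Vs Ui D.b1 := fun h => Vs_mono h fun _ _ hγ => hγ.2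
    have tot : (v0 + v0' + mv 2 D.M w0) + (vi + vi' + mv 2 D.M wi) = 0 := by
      have : mv 2 D.M g = v0 + vi + (v0' + vi') + mv 2 D.M w0 + mv 2 D.M wi := by
        rw [gsum, map_add, map_add, map_add, ev, ev']
      rw [Mg] at this
      rw [this]; abel
    have z0 : v0 + v0' + mv 2 D.M w0 = 0 := by
      refine eq_zero_V (N := U0) (N' := Ui) (b := D.b1) ?_ ?_ ?_
      · intro y γ h1 h2
        simp only [U0, Ui, H1_false, H1_true, Dat.b1] at *
        omega
      · exact Submodule.add_mem _ (Submodule.add_mem _ (toU0 mv0) (toU0 mv0')) (mv_mem D.HM pU0 mw0)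
      · rw [eq_neg_of_add_eq_zero_left tot]
        exact Submodule.neg_mem _
          (Submodule.add_mem _ (Submodule.add_mem _ (toUi mvi) (toUi mvi')) (mv_mem D.HM pUi mwi))
    have zi : vi + vi' + mv 2 D.M wi = 0 := by rw [z0, zero_add] at tot; exact tot
    have sepS : ∀ (v v' : A1 → LR k n 2) (w : A2 → LR k n 2), v ∈ Vs S0 D.b1 → v' ∈ Vs Si D.b1 →
        v + v' + mv 2 D.M w = 0 → mv 2 D.f v = 0 ∧ mv 2 D.f v' = 0 := by
      intro v v' w h1 h2 h3
      have h4 := congrArg (mv 2 D.f) h3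
      rw [map_add, map_add, mv_mv _ _ D.fM w, add_zero, map_zero] at h4
      have h5 : mv 2 D.f v = 0 := by
        refine eq_zero_V (N := S0) (N' := Si) (b := D.b0) ?_ (mv_mem D.Hf pS0 h1) ?_
        · intro y γ h1 h2
          simp only [S0, Si, H1_false, H1_true, Dat.b0] at *
          omega
        · rw [eq_neg_of_add_eq_zero_left h4]
          exact Submodule.neg_mem _ (mv_mem D.Hf pSi h2)
      refine ⟨h5, ?_⟩
      rw [h5, zero_add] at h4; exact h4
    have toS : ∀ {N N' : ℤ → Set (Fin 2 → ℤ)} {v : A1 → LR k n 2},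
        v ∈ Vs (fun t => N t ∩ N' t) D.b1 → v ∈ Vs N D.b1 := fun h => Vs_mono h fun _ _ hγ => hγ.1
    obtain ⟨f0, f0'⟩ := sepS v0 v0' w0 (toS mv0) (toS mv0') z0
    obtain ⟨fi, fi'⟩ := sepS vi vi' wi (toS mvi) (toS mvi') zi
    have cnd : ∀ (s s' : Bool) (τ τ' t : ℤ), Cnd ![s, s'] ![τ, τ'] t = H1 0 s τ t ∩ H1 1 s' τ' t := by
      intro s s' τ τ' t
      ext γ
      simp only [Cnd, Set.mem_ofPred_eq, Fin.forall_fin_two, Set.mem_inter_iff, H1]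
      rfl
    have lift2 : ∀ (s s' : Bool) (τ τ' : ℤ) (v : A1 → LR k n 2),
        v ∈ Vs (fun t => H1 0 s τ t ∩ H1 1 s' τ' t) D.b1 → mv 2 D.f v = 0 →
        ∃ y, y ∈ Vs (H1 0 s τ) D.b2 ∧ y ∈ Vs (H1 1 s' τ') D.b2 ∧ v = mv 2 D.M y := by
      intro s s' τ τ' v h1 h2
      obtain ⟨y, my, ey⟩ := lift_c D.ex1 D.Hf D.HM ![s, s'] ![τ, τ'] (v := v)
        (Vs_mono h1 fun y => (cnd _ _ _ _ _).symm.subset) h2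
      refine ⟨y, Vs_mono my fun y => ?_, Vs_mono my fun y => ?_, ey⟩
      · rw [cnd]; exact Set.inter_subset_left
      · rw [cnd]; exact Set.inter_subset_right
    obtain ⟨y0, y0S, y0U, e0⟩ := lift2 _ _ _ _ v0 mv0 f0
    obtain ⟨yi, yiS, yiU, ei⟩ := lift2 _ _ _ _ vi mvi fi
    obtain ⟨y0', y0S', y0U', e0'⟩ := lift2 _ _ _ _ v0' mv0' f0'
    obtain ⟨yi', yiS', yiU', ei'⟩ := lift2 _ _ _ _ vi' mvi' fi'
    obtain ⟨x0, mx0, ex0⟩ := lift_1 D.ex2 D.HM D.HL 0 false 0 (v := p - y0 - yi)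
      (Submodule.sub_mem _ (Submodule.sub_mem _ mp y0S) yiS)
      (by rw [map_sub, map_sub, ev, ← e0, ← ei]; abel)
    obtain ⟨x1, mx1, ex1⟩ := lift_1 D.ex2 D.HM D.HL 0 true (-1) (v := q - y0' - yi')
      (Submodule.sub_mem _ (Submodule.sub_mem _ mq y0S') yiS')
      (by rw [map_sub, map_sub, ev', ← e0', ← ei']; abel)
    obtain ⟨x2, mx2, ex2⟩ := lift_1 D.ex2 D.HM D.HL 1 false 0 (v := y0 + y0' + w0)
      (Submodule.add_mem _ (Submodule.add_mem _ y0U y0U') mw0)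
      (by rw [map_add, map_add, ← e0, ← e0', z0])
    obtain ⟨x3, mx3, ex3⟩ := lift_1 D.ex2 D.HM D.HL 1 true (d - 1) (v := yi + yi' + wi)
      (Submodule.add_mem _ (Submodule.add_mem _ yiU yiU') mwi)
      (by rw [map_add, map_add, ← ei, ← ei', zi])
    have hL : mv 2 D.L (z - (x0 + x1 + x2 + x3)) = 0 := by
      rw [map_sub, map_add, map_add, map_add, ← ex0, ← ex1, ← ex2, ← ex3, ← hg, gsum]; abel
    have hzx : z = x0 + x1 + x2 + x3 := sub_eq_zero.1 (D.L_inj hL)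
    have zout : z ∈ Vs (outD d) D.b3 := by
      rw [hzx]
      refine Submodule.add_mem _ (Submodule.add_mem _ (Submodule.add_mem _ ?_ ?_) ?_) ?_
      · refine Vs_mono mx0 fun y γ hγ => ?_
        simp only [outD, Set.mem_ofPred_eq, H1_false] at *; omega
      · refine Vs_mono mx1 fun y γ hγ => ?_
        simp only [outD, Set.mem_ofPred_eq, H1_true] at *; omega
      · refine Vs_mono mx2 fun y γ hγ => ?_
        simp only [outD, Set.mem_ofPred_eq, H1_false] at *; omega
      · refine Vs_mono mx3 fun y γ hγ => ?_
        simp only [outD, Set.mem_ofPred_eq, H1_true] at *; omega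
    have z00 : z = 0 := by
      ext1 t
      refine eq_zero_of_disj ?_ (inc_mem _ x t) (zout t)
      intro γ h1 h2
      rw [mem_eD] at h1
      have hm : mZ t ≤ D.lam t := by simp only [mZ]; split_ifs <;> omega
      simp only [outD, Set.mem_ofPred_eq, Dat.b3] at h2
      push_cast at *
      omega
    rw [← red_inc (k := k) (n := n) (eD d D.lam mZ) (eD_inj _ _) x, ← hz, z00, map_zero]
  have hinj : Function.Injective ψ := by
    rw [injective_iff_map_eq_zero]; exact key
  have := card_le_of_injective (GA k n 2) ψ hinj
  simp only [Fintype.card_sigma, Fintype.card_prod, Fintype.card_fin] at this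
  exact this

end

section

lemma abel_ineq {A2 A3 : Type} [Fintype A2] [Fintype A3] (a : A3 → ℚ) (l : A3 → ℕ) (b : A2 → ℚ) (κ : A2 → ℕ)
    (m : ℕ → ℚ) (hm : Antitone m) (hm0 : ∀ c, 0 ≤ m c)
    (h : ∀ c, ∑ z, (if l z ≤ c then a z else 0) ≤ ∑ y, (if κ y ≤ c then b y else 0)) :
    ∑ z, a z * m (l z) ≤ ∑ y, b y * m (κ y) := by
  classical
  let N := ∑ z, l z + ∑ y, κ y
  have hl : ∀ z, l z ≤ N := fun z =>
    (Finset.single_le_sum (f := l) (fun _ _ => Nat.zero_le _) (Finset.mem_univ z)).trans (Nat.le_add_right _ _)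
  have hk : ∀ y, κ y ≤ N := fun y =>
    (Finset.single_le_sum (f := κ) (fun _ _ => Nat.zero_le _) (Finset.mem_univ y)).trans (Nat.le_add_left _ _)
  have tel : ∀ N j : ℕ, j ≤ N → m j = m N + ∑ c ∈ Finset.range N, (if j ≤ c then m c - m (c + 1) else 0) := by
    intro N
    induction N with
    | zero => intro j hj; obtain rfl : j = 0 := by omega
              simp
    | succ N ih =>
      intro j hj
      rw [Finset.sum_range_succ]
      by_cases h1 : j ≤ N
      · rw [if_pos h1, ih j h1]; ring
      · obtain rfl : j = N + 1 := by omega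
        rw [if_neg h1, Finset.sum_eq_zero]
        · simp
        · intro c hc
          rw [Finset.mem_range] at hc
          rw [if_neg (by omega)]
  have gen : ∀ {A : Type} [Fintype A] (a : A → ℚ) (l : A → ℕ), (∀ z, l z ≤ N) →
      ∑ z, a z * m (l z) = m N * (∑ z, (if l z ≤ N then a z else 0)) +
        ∑ c ∈ Finset.range N, (m c - m (c + 1)) * ∑ z, (if l z ≤ c then a z else 0) := by
    intro A _ a l hl
    have : ∀ z, a z * m (l z) = m N * (if l z ≤ N then a z else 0) +
        ∑ c ∈ Finset.range N, (m c - m (c + 1)) * (if l z ≤ c then a z else 0) := by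
      intro z
      conv_lhs => rw [tel N (l z) (hl z)]
      rw [if_pos (hl z), mul_add, Finset.mul_sum, mul_comm]
      congr 1
      refine Finset.sum_congr rfl fun c _ => ?_
      split_ifs <;> ring
    simp_rw [this]
    rw [Finset.sum_add_distrib, Finset.mul_sum, Finset.sum_comm]
    simp_rw [Finset.mul_sum]
  rw [gen a l hl, gen b κ hk]
  refine add_le_add (mul_le_mul_of_nonneg_left (h N) (hm0 N)) (Finset.sum_le_sum fun c _ => ?_)
  exact mul_le_mul_of_nonneg_left (h c) (sub_nonneg.2 (hm (Nat.le_succ c)))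

theorem arith {A2 A3 : Type} [Fintype A2] [Fintype A3] (d : ℕ) (κ : A2 → ℕ) (lam : A3 → ℕ)
    (hκ : ∀ y, 1 ≤ κ y) (hl : ∀ z, 2 ≤ lam z)
    (hC : ∑ y, κ y ≤ d + ∑ z, lam z)
    (hD : ∀ c, ∑ z, (d + lam z) * (if lam z ≤ c + 1 then lam z else 0) ≤
      ∑ y, (d + κ y) * (if κ y ≤ c then κ y else 0)) :
    Fintype.card A2 ≤ d * (d + 2) ∧ Fintype.card A3 ≤ d * (d + 1) / 2 := by
  have hC' : ∑ y, (κ y : ℚ) ≤ d + ∑ z, (lam z : ℚ) := by exact_mod_cast hC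
  have hD' : ∀ c, ∑ z, (if lam z - 1 ≤ c then ((d + lam z) * lam z : ℚ) else 0) ≤
      ∑ y, (if κ y ≤ c then ((d + κ y) * κ y : ℚ) else 0) := by
    intro c
    have h := hD c
    have h1 : ∑ z, (if lam z - 1 ≤ c then ((d + lam z) * lam z : ℚ) else 0) =
      ((∑ z, (d + lam z) * (if lam z ≤ c + 1 then lam z else 0) : ℕ) : ℚ) := by
      push_cast
      refine Finset.sum_congr rfl fun z _ => ?_
      by_cases h : lam z ≤ c + 1
      · rw [if_pos (by omega), if_pos h]
      · rw [if_neg (by omega), if_neg h, mul_zero]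
    have h2 : ∑ y, (if κ y ≤ c then ((d + κ y) * κ y : ℚ) else 0) =
      ((∑ y, (d + κ y) * (if κ y ≤ c then κ y else 0) : ℕ) : ℚ) := by
      push_cast
      refine Finset.sum_congr rfl fun z _ => ?_
      split_ifs <;> simp
    rw [h1, h2]
    exact_mod_cast h
  have hκ' : ∀ y, (1 : ℚ) ≤ κ y := fun y => by exact_mod_cast hκ y
  have hl' : ∀ z, (2 : ℚ) ≤ lam z := fun z => by exact_mod_cast hl z
  have hd : (0 : ℚ) ≤ d := Nat.cast_nonneg d
  constructor
  · have h := abel_ineq _ _ _ _ (fun j => 1 / ((d : ℚ) + j + 1))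
      (by
        intro i j hij
        have : (i : ℚ) ≤ j := by exact_mod_cast hij
        apply one_div_le_one_div_of_le (by positivity)
        linarith) (fun c => by positivity) hD'
    have e1 : ∑ z, ((d + lam z) * lam z : ℚ) * (1 / ((d : ℚ) + ((lam z - 1 : ℕ) : ℚ) + 1)) = ∑ z, (lam z : ℚ) := by
      refine Finset.sum_congr rfl fun z _ => ?_
      rw [Nat.cast_sub (by have := hl z; omega)]
      have := hl' z
      have : (d : ℚ) + lam z ≠ 0 := by positivity
      have e : (d : ℚ) + (lam z - (1 : ℕ)) + 1 = d + lam z := by push_cast; ring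
      rw [e]; field_simp
    have e2 : ∀ y, ((d + κ y) * κ y : ℚ) * (1 / ((d : ℚ) + κ y + 1)) ≤ κ y - 1 / (d + 2) := by
      intro y
      have := hκ' y
      rw [mul_one_div, div_le_iff₀ (by positivity), sub_mul, le_sub_iff_add_le, one_div_mul_eq_div]
      have : ((d : ℚ) + κ y + 1) / (d + 2) ≤ κ y := by
        rw [div_le_iff₀ (by positivity)]; nlinarith
      nlinarith
    have h3 : ∑ z, (lam z : ℚ) ≤ ∑ y, ((κ y : ℚ) - 1 / (d + 2)) := by
      rw [← e1]; exact h.trans (Finset.sum_le_sum fun y _ => e2 y)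
    rw [Finset.sum_sub_distrib, Finset.sum_const, Finset.card_univ, nsmul_eq_mul] at h3
    have h4 : (Fintype.card A2 : ℚ) * (1 / (d + 2)) ≤ d := by linarith
    rw [mul_one_div, div_le_iff₀ (by positivity)] at h4
    exact_mod_cast h4
  · rw [Nat.le_div_iff_mul_le (by norm_num)]
    have h := abel_ineq _ _ _ _ (fun j => 1 / ((d : ℚ) + (max j 1 : ℕ)))
      (by
        intro i j hij
        have : ((max i 1 : ℕ) : ℚ) ≤ (max j 1 : ℕ) := by exact_mod_cast max_le_max hij le_rfl
        have h0 : (1 : ℚ) ≤ (max i 1 : ℕ) := by exact_mod_cast le_max_right i 1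
        apply one_div_le_one_div_of_le (by linarith)
        linarith) (fun c => by positivity) hD'
    obtain ⟨ε, hε1, hε2⟩ : ∃ ε : ℚ, (∀ z, ε * (d + (lam z - 1)) ≤ lam z) ∧
        ∀ x : ℚ, x * ε ≤ d → x * 2 ≤ d * (d + 1) := by
      rcases Nat.eq_zero_or_pos d with rfl | hd0
      · refine ⟨1, fun z => ?_, fun x hx => ?_⟩
        · push_cast; linarith
        · push_cast at *; linarith
      · have hd1 : (1 : ℚ) ≤ d := by exact_mod_cast hd0
        refine ⟨2 / (d + 1), fun z => ?_, fun x hx => ?_⟩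
        · have := hl' z
          rw [div_mul_eq_mul_div, div_le_iff₀ (by positivity)]
          nlinarith
        · rw [mul_div_assoc', div_le_iff₀ (by positivity)] at hx
          exact hx
    have e1 : ∀ z, (lam z : ℚ) + ε ≤ ((d + lam z) * lam z : ℚ) * (1 / ((d : ℚ) + (max (lam z - 1) 1 : ℕ))) := by
      intro z
      have h1 := hl' z
      have h2 := hl z
      rw [max_eq_left (by omega), Nat.cast_sub (by omega), mul_one_div, le_div_iff₀ (by push_cast; linarith)]
      push_cast
      have := hε1 z
      nlinarith
    have e2 : ∑ y, ((d + κ y) * κ y : ℚ) * (1 / ((d : ℚ) + (max (κ y) 1 : ℕ))) = ∑ y, (κ y : ℚ) := by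
      refine Finset.sum_congr rfl fun y _ => ?_
      rw [max_eq_left (hκ y)]
      have := hκ' y
      have : (d : ℚ) + κ y ≠ 0 := by positivity
      field_simp
    have h3 := (Finset.sum_le_sum fun z (_ : z ∈ Finset.univ) => e1 z).trans (h.trans e2.le)
    rw [Finset.sum_add_distrib, Finset.sum_const, Finset.card_univ, nsmul_eq_mul] at h3
    have h4 := hε2 (Fintype.card A3) (by linarith)
    exact_mod_cast h4

end

section

def sigE (b : ℤ → ℕ) (s : Finset ℤ) (hs : ∀ j, b j ≠ 0 → j ∈ s) :
    ((j : ℤ) × Fin (b j)) ≃ ((j : s) × Fin (b j)) where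
  toFun p := ⟨⟨p.1, hs p.1 (by have := p.2.pos; omega)⟩, p.2⟩
  invFun p := ⟨p.1.1, p.2⟩
  left_inv _ := rfl
  right_inv _ := rfl

lemma sig_finite (b : ℤ → ℕ) (hb : (Function.support b).Finite) : Finite ((j : ℤ) × Fin (b j)) :=
  Finite.of_equiv _ (sigE b hb.toFinset (fun j hj => by simpa using hj)).symm

lemma sig_card (b : ℤ → ℕ) (hb : (Function.support b).Finite) [Fintype ((j : ℤ) × Fin (b j))] :
    Fintype.card ((j : ℤ) × Fin (b j)) = ∑ j ∈ hb.toFinset, b j := by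
  rw [Fintype.card_congr (sigE b hb.toFinset (fun j hj => by simpa using hj)), Fintype.card_sigma]
  simp only [Fintype.card_fin]
  exact Finset.sum_coe_sort hb.toFinset b

variable {k : Type} [Field k] {n : ℕ} {W : Type} [AddCommGroup W] [Module (MvPolynomial (Fin n) k) W]

abbrev Rs (k : Type) [Field k] (n : ℕ) (W : Type) [AddCommGroup W] [Module (MvPolynomial (Fin n) k) W] :=
  MinGradedFreeRes (MvPolynomial (Fin n) k) (fun m => {f | MvPolynomial.IsHomogeneous f m}) W

abbrev Ix (res : Rs k n W) (i : ℕ) : Type := (j : ℤ) × Fin (res.β i j)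

noncomputable def mt (res : Rs k n W) (i : ℕ) (x : Ix res i) (y : Ix res (i + 1)) : MvPolynomial (Fin n) k :=
  res.d i (Finsupp.single y 1) x

noncomputable instance (res : Rs k n W) (i : ℕ) : Fintype (Ix res i) :=
  @Fintype.ofFinite _ (sig_finite _ (res.finβ i))

lemma d_apply (res : Rs k n W) (i : ℕ) (v : FreeMod (MvPolynomial (Fin n) k) (res.β (i + 1))) (x : Ix res i) :
    res.d i v x = ∑ y, mt res i x y * v y := by
  classical
  have h : v = ∑ y, v y • Finsupp.single y (1 : MvPolynomial (Fin n) k) := by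
    refine Finsupp.ext fun y => ?_
    rw [Finsupp.finsetSum_apply]
    simp [Finsupp.single_apply]
  conv_lhs => rw [h]
  rw [map_sum, Finsupp.finsetSum_apply]
  refine Finset.sum_congr rfl fun y _ => ?_
  rw [map_smul, Finsupp.smul_apply, smul_eq_mul, mul_comm]; rfl

lemma mt_HD (res : Rs k n W) (i : ℕ) (x : Ix res i) (y : Ix res (i + 1)) : HD (mt res i x y) (y.1 - x.1) :=
  res.graded i y.1 y.2 x.1 x.2

lemma mt_lt (res : Rs k n W) (i : ℕ) (x : Ix res i) (y : Ix res (i + 1)) (h : mt res i x y ≠ 0) : x.1 < y.1 :=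
  res.minimal i y.1 y.2 x.1 x.2 h

lemma mt_const (res : Rs k n W) (i : ℕ) (x : Ix res i) (y : Ix res (i + 1)) :
    constantCoeff (mt res i x y) = 0 := by
  by_cases h : mt res i x y = 0
  · rw [h, map_zero]
  have hlt := mt_lt res i x y h
  rcases mt_HD res i x y with h' | ⟨m, hm, hh⟩
  · exact absurd h' h
  · rw [constantCoeff_eq]
    apply hh.coeff_eq_zero
    simp
    omega

lemma mt_mt (res : Rs k n W) (i : ℕ) (x : Ix res i) (z : Ix res (i + 1 + 1)) :
    ∑ y, mt res i x y * mt res (i + 1) y z = 0 := by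
  have h1 : res.d (i + 1) (Finsupp.single z 1) ∈ LinearMap.ker (res.d i) := by
    rw [← res.exact i]; exact ⟨_, rfl⟩
  have h2 := congrArg (fun v => v x) (LinearMap.mem_ker.1 h1)
  simp only [d_apply res i] at h2
  exact h2

lemma mt_ex (res : Rs k n W) (i : ℕ) : Ex (mt res i) (mt res (i + 1)) := by
  intro v hv
  have h1 : Finsupp.equivFunOnFinite.symm v ∈ LinearMap.ker (res.d i) := by
    rw [LinearMap.mem_ker]
    refine Finsupp.ext fun x => ?_
    rw [d_apply]
    exact hv x
  rw [← res.exact i] at h1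
  obtain ⟨w, hw⟩ := h1
  refine ⟨w, fun y => ?_⟩
  rw [← d_apply, hw]; rfl

lemma exists_ne (res : Rs k n W) (i : ℕ) (y : Ix res (i + 1)) : ∃ x, mt res i x y ≠ 0 := by
  classical
  by_contra! h
  obtain ⟨w, hw⟩ := mt_ex res i (Pi.single y 1) (fun x => by
    rw [Finset.sum_eq_single y] <;> simp +contextual [h, Pi.single_apply])
  have h1 := congrArg constantCoeff (hw y)
  rw [map_sum] at h1
  simp [mt_const] at h1

theorem main (res : Rs k n W) (d : ℕ)
    (h0 : ∀ j : ℤ, res.β 0 j = if j = 0 then 1 else 0)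
    (h1 : ∀ j : ℤ, res.β 1 j ≠ 0 → j = (d : ℤ))
    (h4 : res.β 4 = 0) :
    res.tB 2 ≤ d * (d + 2) ∧ res.tB 3 ≤ d * (d + 1) / 2 := by
  classical
  let x0 : Ix res 0 := ⟨0, ⟨0, by rw [h0]; simp⟩⟩
  have hx0 : ∀ x : Ix res 0, x = x0 := by
    rintro ⟨j, a⟩
    have hj : j = 0 := by
      by_contra hj
      have := a.pos
      have h := h0 j
      rw [if_neg hj] at h
      omega
    subst hj
    have := a.2
    have h := h0 0
    rw [if_pos rfl] at h
    simp only [x0]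
    congr 1
    ext
    simp only []
    omega
  have g1 : ∀ y : Ix res 1, y.1 = d := fun y => h1 y.1 (by have := y.2.pos; omega)
  have g2 : ∀ y : Ix res 2, (d : ℤ) + 1 ≤ y.1 := by
    intro y
    obtain ⟨x, hx⟩ := exists_ne res 1 y
    have := mt_lt res 1 x y hx
    have := g1 x
    omega
  have g3 : ∀ y : Ix res 3, (d : ℤ) + 2 ≤ y.1 := by
    intro y
    obtain ⟨x, hx⟩ := exists_ne res 2 y
    have := mt_lt res 2 x y hx
    have := g2 x
    omega
  have c2 : ∀ y : Ix res 2, ((d + (y.1 - d).toNat : ℕ) : ℤ) = y.1 := fun y => by have := g2 y; omega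
  have c3 : ∀ y : Ix res 3, ((d + (y.1 - d).toNat : ℕ) : ℤ) = y.1 := fun y => by have := g3 y; omega
  let D : Dat k n d (Ix res 1) (Ix res 2) (Ix res 3) :=
    { f := fun _ y => mt res 0 x0 y
      M := mt res 1
      L := mt res 2
      κ := fun y => (y.1 - d).toNat
      lam := fun y => (y.1 - d).toNat
      hf := fun _ y => by rw [← g1 y]; exact mt_HD res 0 x0 y
      hM := fun x y => by rw [c2, ← g1 x]; exact mt_HD res 1 x y
      hL := fun x y => by rw [c2, c3]; exact mt_HD res 2 x y
      fM := fun _ z => mt_mt res 0 x0 z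
      ML := fun x z => mt_mt res 1 x z
      ex1 := fun v hv => mt_ex res 0 v (fun x => by rw [hx0 x]; exact hv ())
      ex2 := mt_ex res 1
      ex3 := fun v hv => by
        obtain ⟨w, hw⟩ := mt_ex res 2 v hv
        refine ⟨fun e => e.elim, fun y => ?_⟩
        rw [hw y]
        have : IsEmpty (Ix res 4) := ⟨fun p => by
          have := p.2.pos
          have h : res.β 4 p.1 = 0 := (congrArg (fun f => f p.1) h4).trans rfl
          omega⟩
        rw [Finset.sum_eq_zero (fun (z : Ix res 4) _ => isEmptyElim z)]
        simp }
  have hlt : ∀ y z, D.L y z ≠ 0 → D.κ y < D.lam z := by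
    intro y z h
    have := mt_lt res 2 y z h
    have := g2 y
    simp only [D]
    omega
  have := arith d D.κ D.lam (fun y => by have := g2 y; simp only [D]; omega)
    (fun y => by have := g3 y; simp only [D]; omega) (ineqC D) (fun c =>
      ineqD D (fun y => D.κ y ≤ c) (fun z => D.lam z ≤ c + 1) (fun y z hz hy => by
        by_contra h
        have := hlt y z h
        omega))
  rw [sig_card _ (res.finβ 2), sig_card _ (res.finβ 3)] at this
  exact this

end

end BB

/-- Let `I ⊂ S` be a homogeneous `d`-equigenerated ideal of height
`c ≥ 2` and projective dimension `3`.  Then `β₂(S/I) ≤ d(d+2)` and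
`β₃(S/I) ≤ d(d+1)/2`. -/
theorem betti_bounds_pd_three
    (k : Type) [Field k] (n : ℕ) (I : Ideal (MvPolynomial (Fin n) k)) (d : ℕ)
    (hgen : ∃ G : Set (MvPolynomial (Fin n) k),
      (∀ g ∈ G, MvPolynomial.IsHomogeneous g d) ∧ Ideal.span G = I)
    (res : MinGradedFreeRes (MvPolynomial (Fin n) k)
      (fun m => {f | MvPolynomial.IsHomogeneous f m})
      (MvPolynomial (Fin n) k ⧸ I))
    (h0 : ∀ j : ℤ, res.β 0 j = if j = 0 then 1 else 0)
    (h1 : ∀ j : ℤ, res.β 1 j ≠ 0 → j = (d : ℤ))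
    (p : ℕ) (hlen : ∀ i, p < i → res.β i = 0) (hp : res.β p ≠ 0)
    (hht : 2 ≤ idealHeight I) (hp3 : p = 3) :
    res.tB 2 ≤ d * (d + 2) ∧ res.tB 3 ≤ d * (d + 1) / 2 := by
  subst hp3
  exact BB.main res d h0 h1 (hlen 4 (by norm_num))
end

section
/- Let S be a standard graded polynomial ring over a field k and I ⊂ S a homogeneous ideal of height c ≥ 2 and projective dimension p that satisfies condition N_{d,q}. Then β_t(S/I) ≤ C(d+t−2, t−1)·C(d+p−1, p−t) for all 2 ≤ t ≤ q. -/
section Aux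
open MvPolynomial Matrix

/-- linear substitution data -/
lemma exists_theta {K : Type} [Field K] (m : ℕ) (a : Fin (m+1) → K) (i0 : Fin (m+1)) (ha : a i0 ≠ 0) :
    ∃ (θ : MvPolynomial (Fin (m+1)) K →ₐ[K] MvPolynomial (Fin m) K)
      (σ : MvPolynomial (Fin m) K →ₐ[K] MvPolynomial (Fin (m+1)) K),
      (∀ i, (θ (X i)).IsHomogeneous 1) ∧ (∀ f, θ (σ f) = f) ∧
      (∀ j, σ (X j) = X (i0.succAbove j)) ∧ (∀ f, θ f = 0 → ∃ g, f = (∑ i, C (a i) * X i) * g) ∧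
      θ (∑ i, C (a i) * X i) = 0 := by
  classical
  let b : Fin (m+1) → MvPolynomial (Fin m) K :=
    i0.insertNth (α := fun _ => MvPolynomial (Fin m) K)
      (- ∑ j : Fin m, C (a (i0.succAbove j) / a i0) * X j) (fun j => X j)
  have hb0 : b i0 = - ∑ j : Fin m, C (a (i0.succAbove j) / a i0) * X j := by simp [b]
  have hbj : ∀ j, b (i0.succAbove j) = X j := by intro j; simp [b]
  let θ : MvPolynomial (Fin (m+1)) K →ₐ[K] MvPolynomial (Fin m) K := aeval b
  let σ : MvPolynomial (Fin m) K →ₐ[K] MvPolynomial (Fin (m+1)) K :=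
    aeval (fun j => X (i0.succAbove j))
  set l : MvPolynomial (Fin (m+1)) K := ∑ i, C (a i) * X i with hl
  have hCC : ∀ j : Fin m, (C (a i0) : MvPolynomial (Fin m) K) * C (a (i0.succAbove j) / a i0)
      = C (a (i0.succAbove j)) := by
    intro j; rw [← C_mul]; congr 1; field_simp
  refine ⟨θ, σ, ?_, ?_, ?_, ?_, ?_⟩
  · intro i
    have : θ (X i) = b i := by simp [θ]
    rw [this]
    rcases Fin.eq_self_or_eq_succAbove i0 i with rfl | ⟨j, rfl⟩
    · rw [hb0]
      apply IsHomogeneous.neg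
      apply IsHomogeneous.sum
      intro j _
      exact (isHomogeneous_X K j).C_mul _
    · rw [hbj]; exact isHomogeneous_X K j
  · intro f
    have : θ.comp σ = AlgHom.id K _ := by
      apply MvPolynomial.algHom_ext
      intro j
      simp [θ, σ, hbj]
    exact DFunLike.congr_fun this f
  · intro j; simp [σ]
  · intro f hf
    let q := Ideal.Quotient.mkₐ K (Ideal.span {l})
    have : (q.comp σ).comp θ = q := by
      apply MvPolynomial.algHom_ext
      intro i
      rcases Fin.eq_self_or_eq_succAbove i0 i with rfl | ⟨j, rfl⟩
      · have e1 : θ (X i) = b i := by simp [θ]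
        simp only [AlgHom.comp_apply, e1]
        simp only [q, Ideal.Quotient.mkₐ_eq_mk]
        rw [Ideal.Quotient.eq, Ideal.mem_span_singleton]
        refine ⟨- C (a i)⁻¹, ?_⟩
        rw [hb0, hl, Fin.sum_univ_succAbove _ i]
        simp only [σ, map_neg, map_sum, map_mul, aeval_X, algHom_C, algebraMap_eq]
        have : (C (a i) : MvPolynomial (Fin (m+1)) K) * C (a i)⁻¹ = 1 := by
          rw [← C_mul, mul_inv_cancel₀ ha, C_1]
        have e2 : ∀ j : Fin m, (C (a (i.succAbove j) / a i) : MvPolynomial (Fin (m+1)) K)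
            = C (a (i.succAbove j)) * C (a i)⁻¹ := by
          intro j; rw [← C_mul, div_eq_mul_inv]
        simp only [e2]
        have e3 : ∑ x : Fin m, C (a (i.succAbove x)) * C (a i)⁻¹ * X (i.succAbove x)
          = (∑ x : Fin m, C (a (i.succAbove x)) * X (i.succAbove x)) * (C (a i)⁻¹ : MvPolynomial (Fin (m+1)) K) := by
          rw [Finset.sum_mul]; apply Finset.sum_congr rfl; intro x _; ring
        rw [e3]
        linear_combination (X i : MvPolynomial (Fin (m+1)) K) * this
      · simp [θ, σ, hbj]
    have h2 := DFunLike.congr_fun this f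
    simp only [AlgHom.comp_apply, hf, map_zero] at h2
    have h3 : f ∈ Ideal.span {l} := by
      rw [← Ideal.Quotient.eq_zero_iff_mem]
      exact h2.symm
    rw [Ideal.mem_span_singleton] at h3
    obtain ⟨g, hg⟩ := h3
    exact ⟨g, hg⟩
  · have : ∀ i, θ (X i) = b i := by simp [θ]
    simp only [hl, map_sum, map_mul, this, algHom_C, algebraMap_eq]
    rw [Fin.sum_univ_succAbove _ i0, hb0]
    simp only [hbj]
    rw [mul_neg, Finset.mul_sum]
    simp only [← mul_assoc, hCC]
    simp

lemma exact_theta {R S : Type} [CommRing R] [CommRing S] (θ : R →+* S) (σ : S → R)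
    (hσ : ∀ s, θ (σ s) = s) (l : R) (hl : ∀ f, θ f = 0 → ∃ g, f = l * g) (hl0 : θ l = 0)
    {α β γ : Type} [Fintype β] [Fintype γ] (Q : Matrix α β R) (T : Matrix β γ R)
    (H : ∀ e : α → R, (∃ h, Q *ᵥ h = l • e) → ∃ h, Q *ᵥ h = e)
    (hQ : ∀ v, Q *ᵥ v = 0 → ∃ w, T *ᵥ w = v) :
    ∀ v, Q.map θ *ᵥ v = 0 → ∃ w, T.map θ *ᵥ w = v := by
  intro v hv
  have e0 : v = θ ∘ (σ ∘ v) := by funext i; simp [hσ]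
  have e1 : ∀ i, θ ((Q *ᵥ (σ ∘ v)) i) = 0 := by
    intro i
    rw [RingHom.map_mulVec, ← e0, hv]; rfl
  choose e he using fun i => hl _ (e1 i)
  obtain ⟨h, hh⟩ := H e ⟨σ ∘ v, by funext i; simp [he]⟩
  obtain ⟨w, hw⟩ := hQ (σ ∘ v - l • h) (by
    rw [Matrix.mulVec_sub, Matrix.mulVec_smul, hh]
    funext i; simp [he])
  refine ⟨θ ∘ w, ?_⟩
  funext i
  rw [← RingHom.map_mulVec, hw]
  simp [hl0, hσ]

lemma regular_of_prev {R : Type} [CommRing R] (l : R) (hl : ∀ f : R, l * f = 0 → f = 0)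
    {ω α β : Type} [Fintype α] [Fintype β] (P : Matrix ω α R) (Q : Matrix α β R)
    (hPQ : P * Q = 0) (hP : ∀ v, P *ᵥ v = 0 → ∃ w, Q *ᵥ w = v) :
    ∀ e : α → R, (∃ h, Q *ᵥ h = l • e) → ∃ h, Q *ᵥ h = e := by
  rintro e ⟨h, hh⟩
  apply hP
  have : l • (P *ᵥ e) = 0 := by
    rw [← Matrix.mulVec_smul, ← hh, Matrix.mulVec_mulVec, hPQ, Matrix.zero_mulVec]
  funext i
  exact hl _ (congrFun this i)

lemma socle_zero {K : Type} [Field K] : ∀ (p m : ℕ), p ≤ m → ∀ (ι : ℕ → Type) [∀ i, Fintype (ι i)]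
    (D : ∀ i, Matrix (ι i) (ι (i+1)) (MvPolynomial (Fin m) K))
    (_ : ∀ i, D i * D (i+1) = 0)
    (_ : ∀ i v, D i *ᵥ v = 0 → ∃ w, D (i+1) *ᵥ w = v)
    (_ : ∀ i, p ≤ i → IsEmpty (ι i))
    (g : ι 0 → MvPolynomial (Fin m) K) (_ : ∀ i : Fin m, ∃ h, D 0 *ᵥ h = (X i : MvPolynomial (Fin m) K) • g),
    ∃ h, D 0 *ᵥ h = g := by
  intro p
  induction p with
  | zero =>
    intro m _ ι _ D _ _ hE g _
    have := hE 0 le_rfl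
    exact ⟨0, Subsingleton.elim _ _⟩
  | succ p ih =>
    intro m hm ι _ D hD hex hE g hg
    obtain ⟨m, rfl⟩ : ∃ m', m = m' + 1 := ⟨m - 1, by omega⟩
    obtain ⟨θ, σ, -, hθσ, hσX, hker, hl0⟩ := exists_theta m (Pi.single 0 1 : Fin (m+1) → K) 0 (by simp)
    have hlX : (∑ i, C ((Pi.single 0 1 : Fin (m+1) → K) i) * X i) = (X 0 : MvPolynomial (Fin (m+1)) K) := by
      rw [Finset.sum_eq_single 0] <;> simp +contextual
    rw [hlX] at hl0 hker
    have hreg : ∀ f : MvPolynomial (Fin (m+1)) K, X 0 * f = 0 → f = 0 := by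
      intro f hf
      exact (mul_eq_zero.mp hf).resolve_left (X_ne_zero 0)
    have hex' := fun i => exact_theta (θ : MvPolynomial (Fin (m+1)) K →+* MvPolynomial (Fin m) K) σ hθσ (X 0) hker hl0 (D (i+1)) (D (i+1+1))
      (regular_of_prev (X 0) hreg (D i) (D (i+1)) (hD i) (hex i)) (hex (i+1))
    obtain ⟨h, hh⟩ := hg 0
    choose hs hhs using hg
    obtain ⟨w, hw⟩ := ih m (by omega) (fun i => ι (i+1)) (fun i => (D (i+1)).map θ)
      (by intro i
          have := congrArg (fun M => M.map θ) (hD (i+1))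
          simpa [Matrix.map_mul] using this)
      hex' (fun i hi => hE (i+1) (by omega)) (θ ∘ h) (by
        intro j
        obtain ⟨w, hw⟩ := hex 0 ((X j.succ : MvPolynomial (Fin (m+1)) K) • h - (X 0 : MvPolynomial (Fin (m+1)) K) • hs j.succ) (by
          rw [Matrix.mulVec_sub, Matrix.mulVec_smul, Matrix.mulVec_smul, hh, hhs, smul_smul, smul_smul, mul_comm, sub_self])
        refine ⟨θ ∘ w, ?_⟩
        funext i
        have := RingHom.map_mulVec (θ : MvPolynomial (Fin (m+1)) K →+* MvPolynomial (Fin m) K) (D (0+1)) w i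
        have h2 : θ (X j.succ) = X j := by
          have := hθσ (X j)
          rw [hσX] at this
          simpa using this
        rw [hw] at this
        simp [hl0, h2] at this
        simp [← this])
    -- h = D 1 w' + X0 * h3
    have e1 : ∀ i, ∃ g', (h - D 1 *ᵥ (σ ∘ w)) i = X 0 * g' := by
      intro i
      apply hker
      have := RingHom.map_mulVec (θ : MvPolynomial (Fin (m+1)) K →+* MvPolynomial (Fin m) K) (D (0+1)) (σ ∘ w) i
      have e : (θ : _ → _) ∘ (σ ∘ w) = w := by funext i; simp [hθσ]
      have h3 := congrFun hw i
      simp at this h3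
      rw [e, h3] at this
      simp [this]
    choose h3 hh3 using e1
    refine ⟨h3, ?_⟩
    have e2 : h - D 1 *ᵥ (σ ∘ w) = (X 0 : MvPolynomial (Fin (m+1)) K) • h3 := by
      funext i; simp [← hh3]
    have e3 : (X 0 : MvPolynomial (Fin (m+1)) K) • (D 0 *ᵥ h3 - g) = 0 := by
      rw [smul_sub, ← Matrix.mulVec_smul, ← e2, ← hh, Matrix.mulVec_sub, Matrix.mulVec_mulVec, hD 0]
      simp
    have e4 : D 0 *ᵥ h3 - g = 0 := by
      funext i; exact hreg _ (congrFun e3 i)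
    exact sub_eq_zero.mp e4

lemma exists_regular_linear {K : Type} [Field K] [Infinite K] (p m : ℕ) (hp : p ≤ m + 1)
    (ι : ℕ → Type) [∀ i, Fintype (ι i)]
    (D : ∀ i, Matrix (ι i) (ι (i+1)) (MvPolynomial (Fin (m+1)) K))
    (hD : ∀ i, D i * D (i+1) = 0)
    (hex : ∀ i v, D i *ᵥ v = 0 → ∃ w, D (i+1) *ᵥ w = v)
    (hE : ∀ i, p ≤ i → IsEmpty (ι i)) :
    ∃ a : Fin (m+1) → K, a ≠ 0 ∧ ∀ e, (∃ h, D 0 *ᵥ h = (∑ i, C (a i) * X i : MvPolynomial (Fin (m+1)) K) • e) →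
      ∃ h, D 0 *ᵥ h = e := by
  classical
  let R := MvPolynomial (Fin (m+1)) K
  let J : Submodule R (ι 0 → R) := LinearMap.range (D 0).mulVecLin
  have hJ : ∀ e, e ∈ J ↔ ∃ h, D 0 *ᵥ h = e := fun e => Iff.rfl
  let M := (ι 0 → R) ⧸ J
  have hfin : (associatedPrimes R M).Finite := associatedPrimes.finite R M
  let L : (Fin (m+1) → K) →ₗ[K] R := Fintype.linearCombination K (fun i => (X i : R))
  have hL : ∀ a, L a = ∑ i, C (a i) * X i := by
    intro a
    rw [Fintype.linearCombination_apply]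
    exact Finset.sum_congr rfl (fun i _ => MvPolynomial.smul_eq_C_mul _ _)
  let sub : Ideal R → Submodule K (Fin (m+1) → K) := fun P => (P.restrictScalars K).comap L
  let s : Set (Submodule K (Fin (m+1) → K)) := insert ⊥ (sub '' associatedPrimes R M)
  have hs : s.Finite := (hfin.image _).insert _
  have htop : ⊤ ∉ hs.toFinset := by
    rw [Set.Finite.mem_toFinset]
    rintro (h | ⟨P, hP, h⟩)
    · exact top_ne_bot h
    · have hX : ∀ i, (X i : R) ∈ P := by
        intro i
        have : (Pi.single i 1 : Fin (m+1) → K) ∈ sub P := by rw [h]; trivial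
        have h2 : L (Pi.single i 1) ∈ P := this
        rw [hL, Finset.sum_eq_single i] at h2
        · simpa using h2
        · intro j _ hj; simp [hj]
        · simp
      obtain ⟨hPp, z, hz⟩ := (isAssociatedPrime_iff).mp hP
      obtain ⟨g, rfl⟩ := Submodule.Quotient.mk_surjective J z
      have : ∃ h, D 0 *ᵥ h = g := by
        apply socle_zero p (m+1) hp ι D hD hex hE
        intro i
        have := hX i
        rw [hz, Submodule.mem_colon_singleton, ← Submodule.Quotient.mk_smul, Submodule.mem_bot,
          Submodule.Quotient.mk_eq_zero] at this
        exact this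
      rw [← hJ, ← Submodule.Quotient.mk_eq_zero] at this
      apply hPp.ne_top
      rw [Ideal.eq_top_iff_one, hz, this]
      simp [Submodule.mem_colon_singleton]
  have hne := Subspace.biUnion_ne_univ_of_top_notMem htop
  rw [Set.ne_univ_iff_exists_notMem] at hne
  obtain ⟨a, ha⟩ := hne
  simp only [Set.mem_iUnion, not_exists, Set.Finite.mem_toFinset] at ha
  refine ⟨a, ?_, ?_⟩
  · intro h0
    exact ha ⊥ (Set.mem_insert _ _) (by simp [h0])
  · intro e he
    rw [← hJ] at he ⊢
    have h1 : L a ∉ ⋃ P ∈ associatedPrimes R M, (P : Set R) := by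
      simp only [Set.mem_iUnion, not_exists]
      intro P hP hm
      exact ha (sub P) (Set.mem_insert_of_mem _ ⟨P, hP, rfl⟩) hm
    rw [biUnion_associatedPrimes_eq_compl_regular] at h1
    have h2 : IsSMulRegular M (L a) := by simpa using h1
    rw [← hL] at he
    rw [← Submodule.Quotient.mk_eq_zero] at he ⊢
    rw [Submodule.Quotient.mk_smul] at he
    exact h2 (by simpa using he)

/-- A substitution `ψ` keeping the complex exact and homogeneous degrees. -/
def GoodSub {A K : Type} [CommRing A] [Field K] (hom : ℕ → Set A) (ι : ℕ → Type) [∀ i, Fintype (ι i)]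
    (D : ∀ i, Matrix (ι i) (ι (i+1)) A) (m : ℕ) : Prop :=
  ∃ ψ : A →+* MvPolynomial (Fin m) K, (∀ e f, f ∈ hom e → (ψ f).IsHomogeneous e) ∧
    ∀ i v, (D i).map ψ *ᵥ v = 0 → ∃ w, (D (i+1)).map ψ *ᵥ w = v

lemma GoodSub.step {A K : Type} [CommRing A] [Field K] [Infinite K] {hom : ℕ → Set A} {ι : ℕ → Type} [∀ i, Fintype (ι i)]
    {D : ∀ i, Matrix (ι i) (ι (i+1)) A} (hD : ∀ i, D i * D (i+1) = 0)
    {p m : ℕ} (hE : ∀ i, p < i → IsEmpty (ι i)) (hp : p ≤ m)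
    (h : GoodSub (K := K) hom ι D (m+1)) : GoodSub (K := K) hom ι D m := by
  obtain ⟨ψ, hψ, hex⟩ := h
  have hD' : ∀ i, (D i).map ψ * (D (i+1)).map ψ = 0 := by
    intro i
    have := congrArg (fun M => M.map ψ) (hD i)
    simpa [Matrix.map_mul] using this
  obtain ⟨a, ha, hreg⟩ := exists_regular_linear (p+1) m (by omega) ι (fun i => (D i).map ψ) hD' hex
    (fun i hi => hE i (by omega))
  obtain ⟨i0, hi0⟩ := Function.ne_iff.mp ha
  obtain ⟨θ, σ, hθ1, hθσ, hσX, hker, hl0⟩ := exists_theta m a i0 hi0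
  have hlne : (∑ i, C (a i) * X i : MvPolynomial (Fin (m+1)) K) ≠ 0 := by
    intro h0
    have := congrArg (coeff (Finsupp.single i0 1)) h0
    rw [coeff_sum, Finset.sum_eq_single i0] at this
    · simp at this; exact hi0 this
    · intro j _ hj
      simp [coeff_C_mul, coeff_X, Finsupp.single_left_inj, hj]
    · simp
  refine ⟨(θ : MvPolynomial (Fin (m+1)) K →+* MvPolynomial (Fin m) K).comp ψ, ?_, ?_⟩
  · intro e f hf
    have h1 := (hψ e f hf).aeval (fun i => θ (X i)) hθ1
    rw [one_mul] at h1
    have : aeval (fun i => θ (X i)) = θ := by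
      apply MvPolynomial.algHom_ext; intro i; simp
    rw [this] at h1
    exact h1
  · intro i
    have e : ∀ i, (D i).map ((θ : MvPolynomial (Fin (m+1)) K →+* MvPolynomial (Fin m) K).comp ψ)
      = ((D i).map ψ).map (θ : MvPolynomial (Fin (m+1)) K →+* MvPolynomial (Fin m) K) := by
      intro i; simp [Matrix.map_map]
    rw [e, e]
    apply exact_theta (θ : MvPolynomial (Fin (m+1)) K →+* MvPolynomial (Fin m) K) σ hθσ _ hker hl0 _ _ ?_ (hex i)
    cases i with
    | zero => exact hreg
    | succ i =>
      exact regular_of_prev _ (fun f hf => (mul_eq_zero.mp hf).resolve_left hlne) _ _ (hD' i) (hex i)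

lemma GoodSub.down {A K : Type} [CommRing A] [Field K] [Infinite K] {hom : ℕ → Set A} {ι : ℕ → Type} [∀ i, Fintype (ι i)]
    {D : ∀ i, Matrix (ι i) (ι (i+1)) A} (hD : ∀ i, D i * D (i+1) = 0)
    {p : ℕ} (hE : ∀ i, p < i → IsEmpty (ι i)) : ∀ n, GoodSub (K := K) hom ι D n →
      ∃ m, m ≤ p ∧ GoodSub (K := K) hom ι D m := by
  intro n
  induction n with
  | zero => intro h; exact ⟨0, Nat.zero_le _, h⟩
  | succ n ih =>
    intro h
    by_cases hn : n + 1 ≤ p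
    · exact ⟨_, hn, h⟩
    · exact ih (h.step hD hE (by omega))

lemma flat_exact {A B : Type} [CommRing A] [CommRing B] [Algebra A B] [Module.Flat A B]
    {α β γ : Type} [Fintype α] [Fintype β] [Fintype γ] (Q : Matrix α β A) (T : Matrix β γ A)
    (hQT : Q * T = 0)
    (hQ : ∀ v, Q *ᵥ v = 0 → ∃ w, T *ᵥ w = v) :
    ∀ v, Q.map (algebraMap A B) *ᵥ v = 0 → ∃ w, T.map (algebraMap A B) *ᵥ w = v := by
  classical
  have hE : Function.Exact T.mulVecLin Q.mulVecLin := by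
    intro v
    constructor
    · intro h; exact hQ v h
    · rintro ⟨w, rfl⟩
      simp [Matrix.mulVec_mulVec, hQT]
  have hE2 := Module.Flat.lTensor_exact B hE
  have key : ∀ {α β : Type} [Fintype α] [Fintype β] [DecidableEq α] [DecidableEq β] (Q : Matrix α β A)
    (x : TensorProduct A B (β → A)),
      TensorProduct.piScalarRight A A B α (Q.mulVecLin.lTensor B x) =
        Q.map (algebraMap A B) *ᵥ (TensorProduct.piScalarRight A A B β x) := by
    intro α β _ _ _ _ Q x
    induction x with
    | zero => simp
    | add x y hx hy => simp only [map_add, hx, hy, Matrix.mulVec_add]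
    | tmul b f =>
      funext i
      simp [Matrix.mulVec, dotProduct, Algebra.smul_def, Finset.sum_mul, mul_assoc]
  intro v hv
  obtain ⟨x, rfl⟩ := (TensorProduct.piScalarRight A A B β).surjective v
  rw [← key] at hv
  have h0 : Q.mulVecLin.lTensor B x = 0 := by
    apply (TensorProduct.piScalarRight A A B α).injective
    rw [hv, map_zero]
  obtain ⟨y, rfl⟩ := (hE2 x).mp h0
  exact ⟨_, (key T y).symm⟩

attribute [local instance] MvPolynomial.algebraMvPolynomial in
lemma GoodSub.init {k K : Type} [Field k] [Field K] [Algebra k K] {n : ℕ} {ι : ℕ → Type} [∀ i, Fintype (ι i)]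
    {D : ∀ i, Matrix (ι i) (ι (i+1)) (MvPolynomial (Fin n) k)} (hD : ∀ i, D i * D (i+1) = 0)
    (hex : ∀ i v, D i *ᵥ v = 0 → ∃ w, D (i+1) *ᵥ w = v) :
    GoodSub (K := K) (fun m => {f | MvPolynomial.IsHomogeneous f m}) ι D n := by
  have : Module.Flat (MvPolynomial (Fin n) k) (MvPolynomial (Fin n) K) := by
    have : Algebra.IsPushout k (MvPolynomial (Fin n) k) K (MvPolynomial (Fin n) K) := inferInstance
    exact Module.Flat.isBaseChange k _ K _ this.out
  refine ⟨algebraMap _ _, ?_, fun i => flat_exact _ _ (hD i) (hex i)⟩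
  intro e f hf
  exact MvPolynomial.IsHomogeneous.map hf (algebraMap k K)

section Count
variable {K : Type} [Field K] {m : ℕ} {V : ℕ → Type} [∀ i, AddCommGroup (V i)] [∀ i, Module K (V i)]

def Van (f : V 0 →ₗ[K] MvPolynomial (Fin m) K) (Y : ∀ i, Fin m → V (i+1) →ₗ[K] V i) :
    (i : ℕ) → ℕ → V i → Prop
  | 0, s, v => ∀ u : Fin m →₀ ℕ, (∃ j : Fin m, s ≤ (j : ℕ) ∧ u j ≠ 0) → coeff u (f v) = 0
  | (i+1), s, v => ∀ j : Fin m, s ≤ (j : ℕ) → Van f Y i (j+1) (Y i j v)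

lemma Van.zero (f : V 0 →ₗ[K] MvPolynomial (Fin m) K) (Y : ∀ i, Fin m → V (i+1) →ₗ[K] V i) :
    ∀ i s, Van f Y i s 0
  | 0, s => by intro u _; simp
  | (i+1), s => by intro j _; rw [map_zero]; exact Van.zero f Y i _

lemma Van.eq_zero (f : V 0 →ₗ[K] MvPolynomial (Fin m) K) (Y : ∀ i, Fin m → V (i+1) →ₗ[K] V i)
    (d r : ℕ)
    (hf0 : ∀ v, (f v).IsHomogeneous (d+1)) (hfinj : ∀ v, f v = 0 → v = 0)
    (hinj : ∀ i < r, ∀ v : V (i+1), (∀ j, Y i j v = 0) → v = 0)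
    (hanti : ∀ i, i + 1 < r → ∀ a b v, Y i a (Y (i+1) b v) + Y i b (Y (i+1) a v) = 0)
    (hsq : ∀ i, i + 1 < r → ∀ a v, Y i a (Y (i+1) a v) = 0)
    (hcyc : 0 < r → ∀ v : V 1, ∑ j, X j * f (Y 0 j v) = 0) :
    ∀ i, i ≤ r → ∀ v : V i, Van f Y i 0 v → v = 0 := by
  classical
  intro i
  induction i with
  | zero =>
    intro _ v hv
    apply hfinj
    ext u
    rw [coeff_zero]
    by_contra hne
    have hdeg : u.degree = d + 1 := by
      by_contra h
      exact hne ((hf0 v).coeff_eq_zero h)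
    have : u ≠ 0 := by rintro rfl; simp at hdeg
    obtain ⟨j, hj⟩ := Finsupp.ne_iff.mp this
    exact hne (hv u ⟨j, Nat.zero_le _, by simpa using hj⟩)
  | succ i ih =>
    intro hi v hv
    apply hinj i (by omega)
    have : ∀ (N : ℕ) (j : Fin m), (j : ℕ) = N → Y i j v = 0 := by
      intro N
      induction N using Nat.strong_induction_on with
      | _ N ihN =>
      intro j hj
      have hlt : ∀ j' : Fin m, j' < j → Y i j' v = 0 := fun j' h => ihN j' (by rw [← hj]; exact h) j' rfl
      have hvj := hv j (Nat.zero_le _)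
      apply ih (by omega)
      cases i with
      | zero =>
        have hz : f (Y 0 j v) = 0 := by
          ext u
          rw [coeff_zero]
          by_cases hu : ∃ l : Fin m, (j : ℕ) + 1 ≤ l ∧ u l ≠ 0
          · exact hvj u hu
          · push Not at hu
            have h1 := congrArg (coeff (u + Finsupp.single j 1)) (hcyc (by omega) v)
            rw [coeff_sum, Finset.sum_eq_single j] at h1
            · rw [mul_comm, coeff_mul_X] at h1
              simpa using h1
            · intro l _ hl
              rcases lt_or_gt_of_ne hl with h | h
              · rw [hlt l h]; simp
              · rw [mul_comm, coeff_mul_X']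
                rw [if_neg]
                simp [Finsupp.mem_support_iff, hu l h, hl.symm]
            · simp
        rw [hfinj _ hz]
        exact Van.zero f Y 0 0
      | succ i =>
        intro j' _
        rcases lt_trichotomy j' j with h | h | h
        · have := hanti i (by omega) j' j v
          rw [hlt j' h, map_zero, add_zero] at this
          rw [this]
          exact Van.zero f Y i _
        · rw [h, hsq i (by omega)]
          exact Van.zero f Y i _
        · exact hvj j' h
    exact fun j => this j j rfl

lemma Van.codim (f : V 0 →ₗ[K] MvPolynomial (Fin m) K) (Y : ∀ i, Fin m → V (i+1) →ₗ[K] V i)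
    (d : ℕ) (hf0 : ∀ v, (f v).IsHomogeneous (d+1)) :
    ∀ ρ i s : ℕ, s + ρ = m → ∃ (E : Type) (_ : Fintype E),
      Fintype.card E = ∑ l ∈ Finset.range ρ, (d + s + l).choose d * l.choose i ∧
      ∃ L : V i →ₗ[K] (E → K), ∀ v, L v = 0 → Van f Y i s v := by
  classical
  intro ρ
  induction ρ with
  | zero =>
    intro i s hs
    refine ⟨Empty, inferInstance, by simp, 0, ?_⟩
    intro v _
    cases i with
    | zero =>
      rintro u ⟨j, hj, _⟩
      have := j.2
      omega
    | succ i =>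
      intro j hj
      have := j.2
      omega
  | succ ρ ih =>
    intro i s hs
    cases i with
    | zero =>
      obtain ⟨E, hE, hc, L, hL⟩ := ih 0 (s+1) (by omega)
      have hsm : s + 1 ≤ m := by omega
      let e : Sym (Fin (s+1)) d → (Fin m →₀ ℕ) := fun σ =>
        Multiset.toFinsupp ((⟨s, hsm⟩ : Fin m) ::ₘ (σ : Multiset (Fin (s+1))).map (Fin.castLE hsm))
      refine ⟨E ⊕ Sym (Fin (s+1)) d, inferInstance, ?_, ?_⟩
      · rw [Fintype.card_sum, hc, Sym.card_sym_eq_choose, Fintype.card_fin, Finset.sum_range_succ']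
        simp only [Nat.choose_zero_right, mul_one]
        congr 1
        · apply Finset.sum_congr rfl
          intro l _
          congr 1
          omega
        · congr 1
          omega
      · let L2 : V 0 →ₗ[K] (Sym (Fin (s+1)) d → K) :=
          LinearMap.pi (fun σ => (MvPolynomial.lcoeff K (e σ)).comp f)
        refine ⟨(LinearEquiv.sumArrowLequivProdArrow E (Sym (Fin (s+1)) d) K K).symm.toLinearMap.comp (L.prod L2), ?_⟩
        intro v hv
        have hv' : (L.prod L2) v = 0 := by
          apply (LinearEquiv.sumArrowLequivProdArrow E (Sym (Fin (s+1)) d) K K).symm.injective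
          rw [map_zero]; exact hv
        have hv1 : L v = 0 := congrArg Prod.fst hv'
        have hv2 : L2 v = 0 := congrArg Prod.snd hv'
        have hV := hL v hv1
        intro u hu
        by_cases hu' : ∃ j : Fin m, s + 1 ≤ (j : ℕ) ∧ u j ≠ 0
        · exact hV u hu'
        · push Not at hu'
          by_cases hdeg : u.degree = d + 1
          swap
          · exact (hf0 v).coeff_eq_zero hdeg
          obtain ⟨j, hj, hjn⟩ := hu
          have hjs : j = ⟨s, hsm⟩ := by
            apply Fin.ext
            by_contra hne
            exact hjn (hu' j (by simp at hne; omega))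
          rw [hjs] at hjn
          have hmem : (⟨s, hsm⟩ : Fin m) ∈ Finsupp.toMultiset u := by
            rw [Finsupp.mem_toMultiset, Finsupp.mem_support_iff]; exact hjn
          obtain ⟨τ, hτ⟩ := Multiset.exists_cons_of_mem hmem
          have hcard : Multiset.card (Finsupp.toMultiset u) = d + 1 := by
            rw [Finsupp.card_toMultiset]
            rw [← hdeg]; rfl
          have hτc : Multiset.card τ = d := by
            rw [hτ, Multiset.card_cons] at hcard; omega
          let g : Fin m → Fin (s+1) := fun i => ⟨min i s, by omega⟩
          let σ : Sym (Fin (s+1)) d := ⟨τ.map g, by simp [hτc]⟩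
          have hτs : ∀ i ∈ τ, (i : ℕ) ≤ s := by
            intro i hi
            by_contra hlt
            have : i ∈ Finsupp.toMultiset u := by rw [hτ]; exact Multiset.mem_cons_of_mem hi
            rw [Finsupp.mem_toMultiset, Finsupp.mem_support_iff] at this
            exact this (hu' i (by omega))
          have heσ : e σ = u := by
            have h1 : (τ.map g).map (Fin.castLE hsm) = τ := by
              rw [Multiset.map_map]
              conv_rhs => rw [← Multiset.map_id τ]
              apply Multiset.map_congr rfl
              intro i hi
              apply Fin.ext
              simp [g, hτs i hi]
            change Multiset.toFinsupp (_ ::ₘ (τ.map g).map (Fin.castLE hsm)) = u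
            rw [h1, ← hτ]
            simp
          have := congrFun hv2 σ
          simpa [L2, heσ] using this
    | succ i =>
      obtain ⟨E1, hE1, hc1, L1, hL1⟩ := ih i (s+1) (by omega)
      obtain ⟨E2, hE2, hc2, L2, hL2⟩ := ih (i+1) (s+1) (by omega)
      have hsm : s < m := by omega
      refine ⟨E1 ⊕ E2, inferInstance, ?_, ?_⟩
      · rw [Fintype.card_sum, hc1, hc2, Finset.sum_range_succ']
        simp only [Nat.choose_zero_succ, mul_zero, add_zero, Nat.choose_succ_succ, mul_add]
        rw [← Finset.sum_add_distrib]
        apply Finset.sum_congr rfl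
        intro l _
        rw [show d + (s+1) + l = d + s + (l+1) by ring]
      · refine ⟨(LinearEquiv.sumArrowLequivProdArrow E1 E2 K K).symm.toLinearMap.comp ((L1.comp (Y i ⟨s, hsm⟩)).prod L2), ?_⟩
        intro v hv
        have hv' : ((L1.comp (Y i ⟨s, hsm⟩)).prod L2) v = 0 := by
          apply (LinearEquiv.sumArrowLequivProdArrow E1 E2 K K).symm.injective
          rw [map_zero]; exact hv
        have hv1 : L1 (Y i ⟨s, hsm⟩ v) = 0 := congrArg Prod.fst hv'
        have hv2 : L2 v = 0 := congrArg Prod.snd hv'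
        have hA := hL1 _ hv1
        have hB := hL2 _ hv2
        intro j hj
        by_cases h : (j : ℕ) = s
        · have : j = ⟨s, hsm⟩ := Fin.ext h
          rw [this]; exact hA
        · exact hB j (by omega)

lemma choose_sum (d r : ℕ) : ∀ m : ℕ, ∑ l ∈ Finset.range m, (d + l).choose d * l.choose r
    = (d + r).choose r * (d + m).choose (d + 1 + r) := by
  intro m
  induction m with
  | zero =>
    rw [Nat.choose_eq_zero_of_lt (by omega : d + 0 < d + 1 + r)]; simp
  | succ m ih =>
    rw [Finset.sum_range_succ, ih]
    have h1 : (d + m + 1).choose (d + 1 + r) = (d+m).choose (d + r) + (d+m).choose (d+1+r) := by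
      rw [show d + 1 + r = (d + r) + 1 by ring, Nat.choose_succ_succ]
    have h2 : (d + m).choose d * m.choose r = (d + r).choose r * (d + m).choose (d + r) := by
      have h3 := Nat.choose_mul (n := d + m) (k := d + r) (s := d) (by omega)
      rw [Nat.add_sub_cancel_left, Nat.add_sub_cancel_left] at h3
      rw [← h3, Nat.choose_symm_add, mul_comm]
    rw [← add_assoc d m 1, h1, h2]; ring

lemma count_bound (f : V 0 →ₗ[K] MvPolynomial (Fin m) K) (Y : ∀ i, Fin m → V (i+1) →ₗ[K] V i)
    (d r : ℕ)
    (hf0 : ∀ v, (f v).IsHomogeneous (d+1)) (hfinj : ∀ v, f v = 0 → v = 0)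
    (hinj : ∀ i < r, ∀ v : V (i+1), (∀ j, Y i j v = 0) → v = 0)
    (hanti : ∀ i, i + 1 < r → ∀ a b v, Y i a (Y (i+1) b v) + Y i b (Y (i+1) a v) = 0)
    (hsq : ∀ i, i + 1 < r → ∀ a v, Y i a (Y (i+1) a v) = 0)
    (hcyc : 0 < r → ∀ v : V 1, ∑ j, X j * f (Y 0 j v) = 0) :
    Module.finrank K (V r) ≤ (d + r).choose r * (d + m).choose (d + 1 + r) := by
  obtain ⟨E, hE, hc, L, hL⟩ := Van.codim f Y d hf0 m r 0 (by omega)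
  have hinjL : Function.Injective L := by
    rw [injective_iff_map_eq_zero]
    intro v hv
    exact Van.eq_zero f Y d r hf0 hfinj hinj hanti hsq hcyc r le_rfl v (hL v hv)
  have := LinearMap.finrank_le_finrank_of_injective hinjL
  rw [Module.finrank_fintype_fun_eq_card, hc] at this
  simp only [add_zero] at this
  rw [← choose_sum]
  exact this
end Count

lemma coeff_mulC_aux {K : Type} [Field K] {m : ℕ} (u : Fin m →₀ ℕ) (c : K) (f : MvPolynomial (Fin m) K) :
    coeff u (f * C c) = coeff u f * c := by
  rw [mul_comm, coeff_C_mul, mul_comm]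

lemma quad_coeff {K : Type} [Field K] {m : ℕ} (z : Fin m → Fin m → K)
    (h : ∑ b, (X b : MvPolynomial (Fin m) K) * (∑ a, X a * C (z a b)) = 0) :
    (∀ a, z a a = 0) ∧ ∀ a b, z a b + z b a = 0 := by
  classical
  have hl : ∀ b c, coeff (Finsupp.single c 1) (∑ a, (X a : MvPolynomial (Fin m) K) * C (z a b)) = z c b := by
    intro b c
    rw [coeff_sum, Finset.sum_eq_single c]
    · rw [coeff_mulC_aux]; simp
    · intro a _ hac
      rw [coeff_mulC_aux, coeff_X, if_neg, zero_mul]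
      simpa [Finsupp.single_left_inj] using hac
    · simp
  have hd : ∀ a, z a a = 0 := by
    intro a
    have h1 := congrArg (coeff (Finsupp.single a 1 + Finsupp.single a 1)) h
    rw [coeff_sum, Finset.sum_eq_single a, coeff_X_mul, hl] at h1
    · simpa using h1
    · intro b _ hb
      rw [coeff_X_mul', if_neg]
      simp [hb.symm]
    · simp
  refine ⟨hd, ?_⟩
  intro a b
  by_cases hab : a = b
  · subst hab; simp [hd]
  · have h1 := congrArg (coeff (Finsupp.single a 1 + Finsupp.single b 1)) h
    rw [coeff_sum, Finset.sum_eq_add a b hab, coeff_X_mul, add_comm (Finsupp.single a 1), coeff_X_mul,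
      hl, hl] at h1
    · rw [add_comm]; simpa using h1
    · intro c _ hc
      rw [coeff_X_mul', if_neg]
      simp [hc.1.symm, hc.2.symm]
    · simp
    · simp

lemma const_inj {K : Type} [Field K] {m : ℕ} {α β γ : Type} [Fintype β] [Fintype γ]
    (Q : Matrix α β (MvPolynomial (Fin m) K)) (T : Matrix β γ (MvPolynomial (Fin m) K))
    (hQ : ∀ v, Q *ᵥ v = 0 → ∃ w, T *ᵥ w = v) (hT : ∀ a b, constantCoeff (T a b) = 0)
    (u : β → K) (hu : Q *ᵥ (C ∘ u) = 0) : u = 0 := by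
  obtain ⟨w, hw⟩ := hQ _ hu
  funext b
  have := congrArg constantCoeff (congrFun hw b)
  rw [Matrix.mulVec, dotProduct, map_sum] at this
  simp only [map_mul, hT, zero_mul, Finset.sum_const_zero, Function.comp, constantCoeff_C] at this
  exact this.symm

lemma linear_expand {K : Type} [Field K] {m : ℕ} (f : MvPolynomial (Fin m) K) (hf : f.IsHomogeneous 1) :
    f = ∑ j, X j * C (coeff (Finsupp.single j 1) f) := by
  classical
  ext u
  rw [coeff_sum]
  simp only [coeff_mulC_aux]
  by_cases hu : u.degree = 1
  · obtain ⟨j, rfl⟩ : ∃ j, u = Finsupp.single j 1 := by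
      have hc : Multiset.card (Finsupp.toMultiset u) = 1 := by
        rw [Finsupp.card_toMultiset, ← hu]; rfl
      obtain ⟨j, hj⟩ := Multiset.card_eq_one.mp hc
      refine ⟨j, ?_⟩
      have h2 := congrArg Multiset.toFinsupp hj
      rwa [Finsupp.toMultiset_toFinsupp, Multiset.toFinsupp_singleton] at h2
    rw [Finset.sum_eq_single j]
    · simp
    · intro i _ hij
      rw [coeff_X, if_neg, zero_mul]
      simpa [Finsupp.single_left_inj] using hij
    · simp
  · rw [hf.coeff_eq_zero hu]
    symm
    apply Finset.sum_eq_zero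
    intro j _
    rw [(isHomogeneous_X K j).coeff_eq_zero hu, zero_mul]

lemma main_over {K : Type} [Field K] {m : ℕ} (ι : ℕ → Type) [∀ i, Fintype (ι i)]
    (E : ∀ i, Matrix (ι i) (ι (i+1)) (MvPolynomial (Fin m) K))
    (hE : ∀ i, E i * E (i+1) = 0)
    (hex : ∀ i v, E i *ᵥ v = 0 → ∃ w, E (i+1) *ᵥ w = v)
    (a0 : ι 0) (ha0 : ∀ a, a = a0) (d r : ℕ)
    (hconst : ∀ i a b, constantCoeff (E i a b) = 0)
    (h0 : ∀ b, (E 0 a0 b).IsHomogeneous (d+1))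
    (h1 : ∀ i < r, ∀ a b, (E (i+1) a b).IsHomogeneous 1) :
    Fintype.card (ι (r+1)) ≤ (d + r).choose r * (d + m).choose (d + 1 + r) := by
  classical
  let V : ℕ → Type := fun i => ι (i+1) → K
  let f : V 0 →ₗ[K] MvPolynomial (Fin m) K := Fintype.linearCombination K (fun b => E 0 a0 b)
  have hf : ∀ v : V 0, f v = (E 0 *ᵥ (C ∘ v)) a0 := by
    intro v
    rw [Fintype.linearCombination_apply]
    simp only [Matrix.mulVec, dotProduct, Function.comp]
    apply Finset.sum_congr rfl
    intro b _
    rw [smul_eq_C_mul, mul_comm]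
  let Y : ∀ i, Fin m → V (i+1) →ₗ[K] V i := fun i j =>
    ((E (i+1)).map (coeff (Finsupp.single j 1))).mulVecLin
  have hinj : ∀ i (v : V i), E i *ᵥ (C ∘ v) = 0 → v = 0 := fun i v hv =>
    const_inj (E i) (E (i+1)) (hex i) (hconst (i+1)) v hv
  have hY : ∀ i < r, ∀ v : V (i+1), E (i+1) *ᵥ (C ∘ v) =
      ∑ j, (X j : MvPolynomial (Fin m) K) • ((C : K →+* MvPolynomial (Fin m) K) ∘ (Y i j v)) := by
    intro i hi v
    funext x
    simp only [Finset.sum_apply, Pi.smul_apply, Function.comp, smul_eq_mul]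
    simp only [Matrix.mulVec, dotProduct]
    have : ∀ j, (C : K →+* MvPolynomial (Fin m) K) (Y i j v x) = ∑ b, C (coeff (Finsupp.single j 1) (E (i+1) x b)) * C (v b) := by
      intro j
      simp only [← C_mul, ← map_sum]
      rfl
    simp only [this, Finset.mul_sum]
    rw [Finset.sum_comm]
    apply Finset.sum_congr rfl
    intro b _
    conv_lhs => rw [linear_expand _ (h1 i hi x b)]
    rw [Finset.sum_mul]
    apply Finset.sum_congr rfl
    intro j _
    simp only [Function.comp]
    ring
  have hquad : ∀ i, i + 1 < r → ∀ (v : V (i+1+1)) x, ∑ b, (X b : MvPolynomial (Fin m) K) *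
      (∑ a, X a * C (Y i a (Y (i+1) b v) x)) = 0 := by
    intro i hi v x
    have e1 : E (i+1) *ᵥ (E (i+1+1) *ᵥ (C ∘ v)) = 0 := by
      rw [Matrix.mulVec_mulVec, hE, Matrix.zero_mulVec]
    rw [hY (i+1) hi, Matrix.mulVec_sum] at e1
    simp only [Matrix.mulVec_smul, hY i (by omega)] at e1
    simpa using congrFun e1 x
  have key := count_bound (V := V) f Y d r ?_ ?_ ?_ ?_ ?_ ?_
  · simpa [V] using key
  · intro v
    rw [hf]
    apply IsHomogeneous.sum
    intro b _
    simpa using (h0 b).mul (isHomogeneous_C (Fin m) (v b))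
  · intro v hv
    apply hinj 0
    funext a
    rw [ha0 a, ← hf, hv]; rfl
  · intro i hi v hv
    apply hinj (i+1)
    rw [hY i hi]
    apply Finset.sum_eq_zero
    intro j _
    rw [hv j]
    funext x
    simp
  · intro i hi a b v
    funext x
    exact (quad_coeff _ (hquad i hi v x)).2 a b
  · intro i hi a v
    funext x
    exact (quad_coeff _ (hquad i hi v x)).1 a
  · intro hr v
    have e1 : E 0 *ᵥ (E (0+1) *ᵥ (C ∘ v)) = 0 := by
      rw [Matrix.mulVec_mulVec, hE, Matrix.zero_mulVec]
    rw [hY 0 hr, Matrix.mulVec_sum] at e1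
    simp only [Matrix.mulVec_smul] at e1
    have e2 := congrFun e1 a0
    simp only [hf]
    simpa using e2

lemma main_abs {k : Type} [Field k] {n : ℕ} (ι : ℕ → Type) [∀ i, Fintype (ι i)]
    (deg : ∀ i, ι i → ℤ)
    (D : ∀ i, Matrix (ι i) (ι (i+1)) (MvPolynomial (Fin n) k))
    (hD : ∀ i, D i * D (i+1) = 0)
    (hex : ∀ i v, D i *ᵥ v = 0 → ∃ w, D (i+1) *ᵥ w = v)
    (hgr : ∀ i a b, D i a b = 0 ∨ ∃ e : ℕ, (e : ℤ) = deg (i+1) b - deg i a ∧ (D i a b).IsHomogeneous e)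
    (hmin : ∀ i a b, D i a b ≠ 0 → deg i a < deg (i+1) b)
    (a0 : ι 0) (ha0 : ∀ a, a = a0) (hdeg0 : deg 0 a0 = 0) (d p q : ℕ)
    (hq1 : 1 ≤ q) (b1 : ι 1) (hdeg1 : ∀ b, deg 1 b = d)
    (hdeg : ∀ i, 1 ≤ i → i ≤ q → ∀ b, deg i b ≤ d + i - 1)
    (hE : ∀ i, p < i → IsEmpty (ι i)) (t : ℕ) (ht : 2 ≤ t) (htq : t ≤ q) (htp : t ≤ p) :
    Fintype.card (ι t) ≤ Nat.choose (d + t - 2) (t - 1) * Nat.choose (d + p - 1) (p - t) := by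
  classical
  -- positive degree
  have hpos : ∀ i a b, D i a b = 0 ∨ ∃ e : ℕ, 0 < e ∧ (e : ℤ) = deg (i+1) b - deg i a ∧ (D i a b).IsHomogeneous e := by
    intro i a b
    by_cases h0 : D i a b = 0
    · exact Or.inl h0
    · right
      obtain ⟨e, he, hh⟩ := (hgr i a b).resolve_left h0
      have := hmin i a b h0
      exact ⟨e, by omega, he, hh⟩
  have hcc : ∀ {K : Type} [Field K] {m : ℕ} (f : MvPolynomial (Fin m) K) (e : ℕ), 0 < e → f.IsHomogeneous e → constantCoeff f = 0 := by
    intro K _ m f e he hf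
    rw [constantCoeff_eq]
    exact hf.coeff_eq_zero (by simp; omega)
  have hconst : ∀ i a b, constantCoeff (D i a b) = 0 := by
    intro i a b
    rcases hpos i a b with h | ⟨e, he, -, hh⟩
    · rw [h, map_zero]
    · exact hcc _ e he hh
  have hcol : ∀ i (b : ι (i+1)), ∃ a, D i a b ≠ 0 := by
    intro i b
    by_contra hcon
    push Not at hcon
    have := const_inj (D i) (D (i+1)) (hex i) (hconst (i+1)) (Pi.single b 1) (by
      funext a
      simp only [Matrix.mulVec, dotProduct, Function.comp]
      rw [Finset.sum_eq_single b]
      · simp [hcon]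
      · intro c _ hc; simp [hc]
      · simp)
    have := congrFun this b
    simp at this
  have hd : 1 ≤ d := by
    obtain ⟨a, ha⟩ := hcol 0 b1
    have := hmin 0 a b1 ha
    rw [ha0 a, hdeg0] at this
    have h2 := hdeg1 b1
    have h3 : deg (0+1) b1 = d := h2
    omega
  have hdegeq : ∀ i, i + 1 ≤ q → ∀ b, deg (i+1) b = d + i := by
    intro i
    induction i with
    | zero => intro _ b; simpa using hdeg1 b
    | succ i ih =>
      intro hi b
      obtain ⟨a, ha⟩ := hcol (i+1) b
      have h1 := hmin _ a b ha
      have h2 := ih (by omega) a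
      have h3 := hdeg (i+1+1) (by omega) hi b
      push_cast at h3 ⊢
      omega
  obtain ⟨m, hmp, ψ, hψ, hexψ⟩ := GoodSub.down hD hE n (GoodSub.init (K := AlgebraicClosure k) hD hex)
  obtain ⟨d, rfl⟩ : ∃ d', d = d' + 1 := ⟨d - 1, by omega⟩
  obtain ⟨r, rfl⟩ : ∃ r, t = r + 1 := ⟨t - 1, by omega⟩
  have key := main_over ι (fun i => (D i).map ψ)
    (by intro i
        have := congrArg (fun M => M.map ψ) (hD i)
        simpa [Matrix.map_mul] using this) hexψ a0 ha0 d r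
    (by
      intro i a b
      rw [Matrix.map_apply]
      rcases hpos i a b with h | ⟨e, he, -, hh⟩
      · rw [h, map_zero, map_zero]
      · exact hcc _ e he (hψ e _ hh))
    (by
      intro b
      rw [Matrix.map_apply]
      rcases hpos 0 a0 b with h | ⟨e, he, hee, hh⟩
      · rw [h, map_zero]; exact isHomogeneous_zero _ _ _
      · have := hdeg1 b
        rw [hdeg0] at hee
        have h3 : deg (0+1) b = ((d+1 : ℕ) : ℤ) := this
        have : e = d + 1 := by omega
        subst this
        exact hψ _ _ hh)
    (by
      intro i hi a b
      rw [Matrix.map_apply]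
      rcases hpos (i+1) a b with h | ⟨e, he, hee, hh⟩
      · rw [h, map_zero]; exact isHomogeneous_zero _ _ _
      · have h1 := hdegeq i (by omega) a
        have h2 := hdegeq (i+1) (by omega) b
        have : e = 1 := by push_cast at h2; omega
        subst this
        exact hψ _ _ hh)
  refine key.trans ?_
  rw [show d + 1 + (r + 1) - 2 = d + r by omega, show r + 1 - 1 = r by omega,
    show d + 1 + p - 1 = d + p by omega]
  apply Nat.mul_le_mul_left
  calc (d + m).choose (d + 1 + r) ≤ (d + p).choose (d + 1 + r) := Nat.choose_le_choose _ (by omega)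
    _ = (d + p).choose (p - (r + 1)) := by
      rw [← Nat.choose_symm (by omega : d + 1 + r ≤ d + p)]
      congr 1
      omega

end Aux

open Matrix in
/-- Let `S` be a standard graded polynomial ring over a field `k` and
`I ⊂ S` a homogeneous ideal of height `c ≥ 2` and projective dimension `p` satisfying
condition `N_{d,q}`.  Then `β_t(S/I) ≤ C(d+t−2, t−1) · C(d+p−1, p−t)` for `2 ≤ t ≤ q`. -/
theorem betti_upper_bound_of_Ndq
    (k : Type) [Field k] (n : ℕ) (I : Ideal (MvPolynomial (Fin n) k)) (d : ℕ)
    (hgen : ∃ G : Set (MvPolynomial (Fin n) k),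
      (∀ g ∈ G, MvPolynomial.IsHomogeneous g d) ∧ Ideal.span G = I)
    (res : MinGradedFreeRes (MvPolynomial (Fin n) k)
      (fun m => {f | MvPolynomial.IsHomogeneous f m})
      (MvPolynomial (Fin n) k ⧸ I))
    (h0 : ∀ j : ℤ, res.β 0 j = if j = 0 then 1 else 0)
    (h1 : ∀ j : ℤ, res.β 1 j ≠ 0 → j = (d : ℤ))
    (p : ℕ) (hlen : ∀ i, p < i → res.β i = 0) (hp : res.β p ≠ 0)
    (c : ℕ) (hc : 2 ≤ c) (hht : idealHeight I = (c : ℕ∞))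
    (q : ℕ) (hq : 1 ≤ q)
    (hN : ∀ i : ℕ, 1 ≤ i → i ≤ q →
      (∀ j : ℤ, res.β i j ≠ 0 → j ≤ (d : ℤ) + i - 1) ∧ res.β i ((d : ℤ) + i - 1) ≠ 0) :
    ∀ t : ℕ, 2 ≤ t → t ≤ q →
      res.tB t ≤ Nat.choose (d + t - 2) (t - 1) * Nat.choose (d + p - 1) (p - t) := by
  classical
  intro t ht htq
  let ι : ℕ → Type := fun i => (j : ℤ) × Fin (res.β i j)
  letI inst : ∀ i, Fintype (ι i) := fun i =>
    ⟨(res.finβ i).toFinset.sigma (fun j => Finset.univ), by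
      rintro ⟨j, a⟩
      refine Finset.mem_sigma.mpr ⟨?_, Finset.mem_univ _⟩
      rw [Set.Finite.mem_toFinset, Function.mem_support]
      have := a.2
      change res.β i j ≠ 0
      omega⟩
  have hcard : ∀ i, res.tB i = Fintype.card (ι i) := by
    intro i
    change _ = Finset.card ((res.finβ i).toFinset.sigma (fun j => Finset.univ))
    rw [Finset.card_sigma]
    simp [MinGradedFreeRes.tB]
  let D : ∀ i, Matrix (ι i) (ι (i+1)) (MvPolynomial (Fin n) k) := fun i =>
    Matrix.of fun a b => res.d i (Finsupp.single b 1) a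
  have hmv : ∀ i (v : ι (i+1) →₀ MvPolynomial (Fin n) k), D i *ᵥ (v : ι (i+1) → _) = (res.d i v : ι i → _) := by
    intro i v
    funext a
    have hv : v = ∑ b, v b • Finsupp.single b (1 : MvPolynomial (Fin n) k) := by
      rw [← Finsupp.sum_fintype v (fun b c => c • Finsupp.single b (1 : MvPolynomial (Fin n) k)) (by simp)]
      simp
    conv_rhs => rw [hv]
    rw [map_sum, Finsupp.finsetSum_apply]
    simp only [Matrix.mulVec, dotProduct, D, Matrix.of_apply]
    apply Finset.sum_congr rfl
    intro b _
    rw [map_smul, Finsupp.smul_apply, smul_eq_mul, mul_comm]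
  have hDD : ∀ i, D i * D (i+1) = 0 := by
    intro i
    ext1 a c
    have h1 := hmv i (res.d (i+1) (Finsupp.single c 1))
    have h2 : res.d i (res.d (i+1) (Finsupp.single c 1)) = 0 := by
      rw [← LinearMap.mem_ker, ← res.exact i]
      exact ⟨_, rfl⟩
    rw [h2] at h1
    exact congrFun h1 a
  have hex : ∀ i v, D i *ᵥ v = 0 → ∃ w, D (i+1) *ᵥ w = v := by
    intro i v hv
    have h1 := hmv i (Finsupp.equivFunOnFinite.symm v)
    rw [Finsupp.coe_equivFunOnFinite_symm, hv] at h1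
    have h2 : Finsupp.equivFunOnFinite.symm v ∈ LinearMap.ker (res.d i) := by
      rw [LinearMap.mem_ker]
      ext1 a
      exact (congrFun h1 a).symm
    rw [← res.exact i] at h2
    obtain ⟨w, hw⟩ := h2
    refine ⟨w, ?_⟩
    rw [hmv, hw]
    exact Finsupp.coe_equivFunOnFinite_symm v
  have hβt := (hN t (by omega) htq).2
  have htp : t ≤ p := by
    by_contra h
    exact hβt (by rw [hlen t (by omega)]; rfl)
  have hβ1 := (hN 1 le_rfl hq).2
  have hβ0 : res.β 0 0 = 1 := by simpa using h0 0
  rw [hcard]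
  refine main_abs ι (fun i b => b.1) D hDD hex ?_ ?_ ⟨0, ⟨0, by omega⟩⟩ ?_ rfl d p q hq
    ⟨_, ⟨0, Nat.pos_of_ne_zero hβ1⟩⟩ ?_ ?_ ?_ t ht htq htp
  · rintro i ⟨j', a'⟩ ⟨j, a⟩
    exact res.graded i j a j' a'
  · rintro i ⟨j', a'⟩ ⟨j, a⟩
    exact res.minimal i j a j' a'
  · rintro ⟨j, a⟩
    have hj : j = 0 := by
      by_contra h
      have h2 := h0 j
      rw [if_neg h] at h2
      have := a.2
      omega
    subst hj
    congr 1
    apply Fin.ext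
    have := a.2
    simp only
    omega
  · rintro ⟨j, a⟩
    exact h1 j (by have := a.2; omega)
  · rintro i hi hiq ⟨j, a⟩
    exact (hN i hi hiq).1 j (by have := a.2; omega)
  · intro i hi
    refine ⟨?_⟩
    rintro ⟨j, a⟩
    have h2 : res.β i j = 0 := by rw [hlen i hi]; rfl
    have := a.2
    omega
end
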